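/- arXiv:1801.04889 — 5 statements merged into one kernel-verified Lean document; each statement's English description precedes it below -/
import Mathlib

section
/- Let (X_n)_{n∈ℕ} be a sequence of metric spaces. The following are equivalent: (a) (X_n) coarsely embeds uniformly into Hilbert space; (b) for all R > 0 and ε > 0 there exist real Hilbert spaces H_n and maps φ_n : X_n → H_n with ‖φ_n(x)‖ = 1 for all n and x ∈ X_n, such that (i) for all n and all x,y ∈ X_n with d(x,y) ≤ R one has ‖φ_n(x) − φ_n(y)‖ ≤ ε, and (ii) for every ε' > 0 there exists M > 0 such that for all n, |⟨φ_n(x), φ_n(y)⟩| ≤ ε' whenever x,y ∈ X_n satisfy d(x,y) ≥ M. -/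
open TensorProduct in
theorem exists_power_kernel (H : Type) [NormedAddCommGroup H] [InnerProductSpace ℝ H] (k : ℕ) :
    ∃ (K : Type) (_ : NormedAddCommGroup K) (_ : InnerProductSpace ℝ K) (_ : CompleteSpace K)
      (f : H → K), ∀ x y, inner ℝ (f x) (f y) = (inner ℝ x y : ℝ) ^ k := by
  induction k with
  | zero => exact ⟨ℝ, inferInstance, inferInstance, inferInstance, fun _ => 1, fun x y => by simp⟩
  | succ k ih =>
    obtain ⟨K, _, _, _, f, hf⟩ := ih
    refine ⟨UniformSpace.Completion (K ⊗[ℝ] H), inferInstance, inferInstance, inferInstance,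
      fun x => ((f x ⊗ₜ[ℝ] x : K ⊗[ℝ] H) : UniformSpace.Completion (K ⊗[ℝ] H)), fun x y => ?_⟩
    rw [UniformSpace.Completion.inner_coe, TensorProduct.inner_tmul, hf, pow_succ]

theorem exists_gaussian (H : Type) [NormedAddCommGroup H] [InnerProductSpace ℝ H] :
    ∃ (K : Type) (_ : NormedAddCommGroup K) (_ : InnerProductSpace ℝ K) (_ : CompleteSpace K)
      (f : H → K), ∀ x y, inner ℝ (f x) (f y) = Real.exp (-(‖x - y‖ ^ 2 / 2)) := by
  choose K i1 i2 i3 f hf using exists_power_kernel H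
  have hn : ∀ k x, ‖f k x‖ ^ 2 = (‖x‖ ^ 2) ^ k := fun k x => by
    rw [← real_inner_self_eq_norm_sq, hf, real_inner_self_eq_norm_sq]
  have hmem : ∀ x, Memℓp (fun k => (√(1 / (k.factorial : ℝ))) • f k x) 2 := by
    intro x
    apply memℓp_gen
    have := Real.summable_pow_div_factorial (‖x‖ ^ 2)
    refine this.congr fun k => ?_
    have h2 : (2 : ENNReal).toReal = ((2 : ℕ) : ℝ) := by norm_num
    rw [h2, Real.rpow_natCast, norm_smul, mul_pow, hn, Real.norm_eq_abs, sq_abs,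
      Real.sq_sqrt (by positivity)]
    ring
  let g : H → lp K 2 := fun x => ⟨fun k => (√(1 / (k.factorial : ℝ))) • f k x, hmem x⟩
  have hg : ∀ x y, inner ℝ (g x) (g y) = Real.exp (inner ℝ x y) := by
    intro x y
    rw [lp.inner_eq_tsum, Real.exp_eq_exp_ℝ, NormedSpace.exp_eq_tsum_div]
    refine tsum_congr fun k => ?_
    change inner ℝ ((√(1 / (k.factorial : ℝ))) • f k x) ((√(1 / (k.factorial : ℝ))) • f k y) = _
    rw [real_inner_smul_left, real_inner_smul_right, hf, ← mul_assoc,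
      Real.mul_self_sqrt (by positivity)]
    ring
  refine ⟨lp K 2, inferInstance, inferInstance, inferInstance,
    fun x => Real.exp (-(‖x‖ ^ 2 / 2)) • g x, fun x y => ?_⟩
  rw [real_inner_smul_left, real_inner_smul_right, hg, ← Real.exp_add, ← Real.exp_add,
    norm_sub_sq_real]
  congr 1
  ring

theorem exists_sum_embedding {X : Type*} (K : ℕ → Type) [∀ k, NormedAddCommGroup (K k)]
    [∀ k, InnerProductSpace ℝ (K k)] [∀ k, CompleteSpace (K k)] (φ : ∀ k, X → K k)
    (hs : ∀ x y, Summable fun k => dist (φ k x) (φ k y) ^ 2) :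
    ∃ (L : Type) (_ : NormedAddCommGroup L) (_ : InnerProductSpace ℝ L) (_ : CompleteSpace L)
      (F : X → L), ∀ x y, dist (F x) (F y) ^ 2 = ∑' k, dist (φ k x) (φ k y) ^ 2 := by
  have h2 : (2 : ENNReal).toReal = ((2 : ℕ) : ℝ) := by norm_num
  rcases isEmpty_or_nonempty X with h | ⟨⟨o⟩⟩
  · exact ⟨ℝ, inferInstance, inferInstance, inferInstance, fun _ => 0, fun x => h.elim x⟩
  · have hmem : ∀ x, Memℓp (fun k => φ k x - φ k o) 2 := by
      intro x
      apply memℓp_gen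
      refine (hs x o).congr fun k => ?_
      rw [h2, Real.rpow_natCast, dist_eq_norm]
    refine ⟨lp K 2, inferInstance, inferInstance, inferInstance,
      fun x => ⟨fun k => φ k x - φ k o, hmem x⟩, fun x y => ?_⟩
    rw [dist_eq_norm, ← real_inner_self_eq_norm_sq, lp.inner_eq_tsum]
    refine tsum_congr fun k => ?_
    rw [real_inner_self_eq_norm_sq, dist_eq_norm]
    congr 2
    change (φ k x - φ k o) - (φ k y - φ k o) = _
    abel

theorem dist_sq_unit {K : Type} [NormedAddCommGroup K] [InnerProductSpace ℝ K] (a b : K)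
    (ha : ‖a‖ = 1) (hb : ‖b‖ = 1) : dist a b ^ 2 = 2 - 2 * inner ℝ a b := by
  rw [dist_eq_norm, norm_sub_sq_real, ha, hb]; ring

/-- A length function on a group. -/
structure IsLengthFunction {G : Type*} [Group G] (ℓ : G → ℝ) : Prop where
  nonneg : ∀ g, 0 ≤ ℓ g
  eq_zero_iff : ∀ g, ℓ g = 0 ↔ g = 1
  inv_eq : ∀ g, ℓ g⁻¹ = ℓ g
  subadd : ∀ g h, ℓ (g * h) ≤ ℓ g + ℓ h

/-- A proper length function: balls are finite. -/
def IsProperLength {G : Type*} [Group G] (ℓ : G → ℝ) : Prop :=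
  IsLengthFunction ℓ ∧ ∀ R : ℝ, {g : G | ℓ g ≤ R}.Finite

/-- The quotient length on the coset space `G ⧸ N`:
`ℓ̄(gN) = inf {ℓ(g') : g'N = gN} = inf {ℓ(gh) : h ∈ N}`. -/
noncomputable def quotLength {G : Type*} [Group G] (ℓ : G → ℝ) (N : Subgroup G) :
    G ⧸ N → ℝ :=
  fun x => sInf {r : ℝ | ∃ g : G, QuotientGroup.mk g = x ∧ ℓ g = r}

/-- The quotient metric on the coset space `G ⧸ N` induced by a length function `ℓ`:
`d̄(xN, yN) = inf {ℓ(g⁻¹h) : gN = xN, hN = yN}`; for normal `N` this is the metric of the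
quotient length. -/
noncomputable def quotDist {G : Type*} [Group G] (ℓ : G → ℝ) (N : Subgroup G) :
    G ⧸ N → G ⧸ N → ℝ :=
  fun x y => sInf {r : ℝ | ∃ g h : G,
    QuotientGroup.mk g = x ∧ QuotientGroup.mk h = y ∧ ℓ (g⁻¹ * h) = r}

/-- A family of spaces (with given distance functions) coarsely embeds uniformly into
Hilbert space: there are real Hilbert spaces `H j`, maps `F j`, and common nondecreasing
control functions `ρ₋, ρ₊` with `ρ₋ → ∞`. -/
def UnifCoarseEmbedHilbert {J : Type*} (X : J → Type*) (d : ∀ j, X j → X j → ℝ) : Prop :=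
  ∃ (H : J → Type) (iN : ∀ j, NormedAddCommGroup (H j))
    (_ : ∀ j, @InnerProductSpace ℝ (H j) inferInstance (iN j).toSeminormedAddCommGroup)
    (_ : ∀ j, @CompleteSpace (H j) (iN j).toMetricSpace.toPseudoMetricSpace.toUniformSpace)
    (F : ∀ j, X j → H j) (ρm ρp : ℝ → ℝ),
    Monotone ρm ∧ Monotone ρp ∧
    Filter.Tendsto ρm Filter.atTop Filter.atTop ∧
    ∀ (j : J) (x y : X j),
      ρm (d j x y) ≤ @dist (H j) (iN j).toMetricSpace.toPseudoMetricSpace.toDist (F j x) (F j y) ∧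
      @dist (H j) (iN j).toMetricSpace.toPseudoMetricSpace.toDist (F j x) (F j y) ≤ ρp (d j x y)

/-- Residual finiteness: every nontrivial element survives in some finite quotient
(equivalently, has nontrivial image under some homomorphism to a finite group). -/
def ResiduallyFinite (G : Type*) [Group G] : Prop :=
  ∀ g : G, g ≠ 1 → ∃ N : Subgroup G, N.Normal ∧ N.FiniteIndex ∧ g ∉ N

/-- Amenability via Reiter's ℓ²-condition: almost-invariant unit vectors in `ℓ²(G)`. -/
def ReiterAmenable (G : Type*) [Group G] : Prop :=
  ∀ (F : Finset G) (ε : ℝ), 0 < ε →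
    ∃ ξ : G → ℝ, Summable (fun x => ξ x ^ 2) ∧ (∑' x, ξ x ^ 2) = 1 ∧
      ∀ g ∈ F, (∑' x, (ξ (g⁻¹ * x) - ξ x) ^ 2) ≤ ε ^ 2

/-- The Schreier metric on the coset space `G ⧸ H` with respect to a (symmetric) set `S`:
the least `m` such that `y = s_m ⋯ s_1 • x` with all `s_i ∈ S`. -/
noncomputable def schreierDist {G : Type*} [Group G] (S : Set G) (H : Subgroup G)
    (x y : G ⧸ H) : ℝ :=
  sInf {r : ℝ | ∃ m : ℕ, r = m ∧ ∃ w : Fin m → G, (∀ i, w i ∈ S) ∧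
    (List.ofFn w).prod • x = y}

/-- The word length with respect to a generating set `S` (closed under inverses). -/
noncomputable def wordLength {G : Type*} [Group G] (S : Set G) (g : G) : ℝ :=
  sInf {r : ℝ | ∃ m : ℕ, r = m ∧ ∃ w : Fin m → G, (∀ i, w i ∈ S) ∧
    (List.ofFn w).prod = g}

/-- The Cheeger constant of a finite `G`-set `V` with respect to `S ⊆ G`:
`min {|∂_S A| / |A| : A ⊆ V nonempty, 2|A| ≤ |V|}`, where
`∂_S A = {(v, s) ∈ A × S : s • v ∉ A}`. -/
noncomputable def cheegerConst {G : Type*} [Group G] (S : Finset G)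
    (V : Type*) [MulAction G V] : ℝ :=
  sInf {r : ℝ | ∃ A : Set V, A.Nonempty ∧ 2 * A.ncard ≤ Nat.card V ∧
    r = (Set.ncard {p : V × G | p.1 ∈ A ∧ p.2 ∈ (S : Set G) ∧ p.2 • p.1 ∉ A} : ℝ) / A.ncard}

/-- Equi-exactness (uniform exactness) of a family of spaces: uniformly bounded,
uniformly Lipschitz partitions of unity. -/
def EquiExact {J : Type*} (X : J → Type*) (d : ∀ j, X j → X j → ℝ) : Prop :=
  ∀ R > (0:ℝ), ∀ ε > (0:ℝ), ∃ C > (0:ℝ), ∀ j, ∃ (I : Type) (φ : I → X j → ℝ),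
    (∀ i x, 0 ≤ φ i x ∧ φ i x ≤ 1) ∧
    (∀ x, HasSum (fun i => φ i x) 1) ∧
    (∀ x y, d j x y ≤ R → ∃ s ≤ ε, HasSum (fun i => |φ i x - φ i y|) s) ∧
    (∀ i x y, φ i x ≠ 0 → φ i y ≠ 0 → d j x y ≤ C)

/-- Characterization of uniform coarse embeddability into Hilbert space
of a sequence of metric spaces via families of unit vectors. -/
theorem statement12 (X : ℕ → Type*) [∀ n, MetricSpace (X n)] :
    UnifCoarseEmbedHilbert X (fun n (x y : X n) => dist x y) ↔
      (∀ R > (0:ℝ), ∀ ε > (0:ℝ),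
        ∃ (H : ℕ → Type) (iN : ∀ n, NormedAddCommGroup (H n))
          (iI : ∀ n, @InnerProductSpace ℝ (H n) inferInstance (iN n).toSeminormedAddCommGroup)
          (_ : ∀ n, @CompleteSpace (H n) (iN n).toMetricSpace.toPseudoMetricSpace.toUniformSpace)
          (φ : ∀ n, X n → H n),
          (∀ n x, @norm (H n) (iN n).toNorm (φ n x) = 1) ∧
          (∀ n (x y : X n), dist x y ≤ R →
            @dist (H n) (iN n).toMetricSpace.toPseudoMetricSpace.toDist (φ n x) (φ n y) ≤ ε) ∧
          (∀ ε' > (0:ℝ), ∃ M > (0:ℝ), ∀ n (x y : X n), dist x y ≥ M →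
            |@inner ℝ (H n) (iI n).toInner (φ n x) (φ n y)| ≤ ε')) := by
  constructor
  · rintro ⟨H, iN, iI, iC, F, ρm, ρp, hm, hp, ht, hF⟩ R hR ε hε
    choose K k1 k2 k3 G hG using fun n => exists_gaussian (H n)
    obtain ⟨c, hc, hcR⟩ : ∃ c > (0:ℝ), c * |ρp R| ≤ ε := by
      refine ⟨ε / (|ρp R| + 1), by positivity, ?_⟩
      rw [div_mul_eq_mul_div, div_le_iff₀ (by positivity)]
      nlinarith [abs_nonneg (ρp R)]
    have hin : ∀ n (x y : X n), inner ℝ (G n (c • F n x)) (G n (c • F n y))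
        = Real.exp (-((c * dist (F n x) (F n y)) ^ 2 / 2)) := by
      intro n x y
      rw [hG, ← smul_sub, norm_smul, dist_eq_norm, Real.norm_eq_abs, abs_of_pos hc]
    have hunit : ∀ n (x : X n), ‖G n (c • F n x)‖ = 1 := by
      intro n x
      have := hin n x x
      rw [real_inner_self_eq_norm_sq] at this
      simp only [dist_self, mul_zero] at this
      norm_num at this
      rcases this with h | h
      · exact h
      · linarith [norm_nonneg (G n (c • F n x))]
    refine ⟨K, k1, k2, k3, fun n x => G n (c • F n x), hunit, ?_, ?_⟩
    · intro n x y hxy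
      have h1 := dist_sq_unit _ _ (hunit n x) (hunit n y)
      rw [hin] at h1
      have h2 := Real.add_one_le_exp (-((c * dist (F n x) (F n y)) ^ 2 / 2))
      have h3 : dist (F n x) (F n y) ≤ |ρp R| :=
        ((hF n x y).2.trans (hp hxy)).trans (le_abs_self _)
      have h4 : c * dist (F n x) (F n y) ≤ ε :=
        (mul_le_mul_of_nonneg_left h3 hc.le).trans hcR
      have h5 : 0 ≤ c * dist (F n x) (F n y) := mul_nonneg hc.le dist_nonneg
      apply abs_le_of_sq_le_sq' _ hε.le |>.2
      nlinarith
    · intro ε' hε'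
      have h1 : Filter.Tendsto (fun t => Real.exp (-((c * ρm t) ^ 2 / 2))) Filter.atTop
          (nhds 0) := by
        apply Real.tendsto_exp_neg_atTop_nhds_zero.comp
        apply Filter.Tendsto.atTop_div_const (by norm_num)
        exact (Filter.tendsto_pow_atTop (by norm_num)).comp (ht.const_mul_atTop hc)
      obtain ⟨M, hM1, hM2, hM3⟩ := ((h1.eventually (gt_mem_nhds hε')).and
        ((Filter.eventually_gt_atTop 0).and (ht.eventually_ge_atTop 0))).exists
      refine ⟨M, hM2, fun n x y hxy => ?_⟩
      simp only [hin]
      rw [abs_of_pos (Real.exp_pos _)]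
      refine le_trans (Real.exp_le_exp.2 ?_) hM1.le
      have h2 : ρm M ≤ dist (F n x) (F n y) := (hm hxy).trans (hF n x y).1
      have h3 : (c * ρm M) ^ 2 ≤ (c * dist (F n x) (F n y)) ^ 2 := by gcongr
      linarith
  · intro h
    have h' := fun k : ℕ => h (k + 1 : ℝ) (by positivity) ((1/2 : ℝ) ^ k) (by positivity)
    choose H iN iI iC φ hu hc hd using h'
    choose M hM0 hM using fun k => hd k (1/2) (by norm_num)
    have hb4 : ∀ k n (x y : X n), dist (φ k n x) (φ k n y) ^ 2 ≤ 4 := by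
      intro k n x y
      have h1 : dist (φ k n x) (φ k n y) ≤ 2 := by
        rw [dist_eq_norm]
        refine (norm_sub_le _ _).trans ?_
        rw [hu, hu]; norm_num
      nlinarith [dist_nonneg (x := φ k n x) (y := φ k n y)]
    have hgeo : ∀ (k n : ℕ) (x y : X n), dist x y ≤ k + 1 →
        dist (φ k n x) (φ k n y) ^ 2 ≤ (1/4 : ℝ) ^ k := by
      intro k n x y hxy
      have h1 := hc k n x y hxy
      calc _ ≤ ((1/2 : ℝ) ^ k) ^ 2 := by gcongr
        _ = _ := by rw [← pow_mul, mul_comm, pow_mul]; norm_num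
    let u : ℝ → ℕ → ℝ := fun t k => (if k < ⌊t⌋₊ then 4 else 0) + (1/4 : ℝ) ^ k
    have hle : ∀ n (x y : X n) k, dist (φ k n x) (φ k n y) ^ 2 ≤ u (dist x y) k := by
      intro n x y k
      have hp : (0:ℝ) ≤ (1/4 : ℝ) ^ k := by positivity
      by_cases hk : k < ⌊dist x y⌋₊
      · simp only [u, if_pos hk]; linarith [hb4 k n x y]
      · simp only [u, if_neg hk, zero_add]
        refine hgeo k n x y ?_
        have := Nat.lt_floor_add_one (dist x y)
        have h2 : (⌊dist x y⌋₊ : ℝ) ≤ k := by exact_mod_cast not_lt.1 hk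
        linarith
    have hgs : Summable fun k : ℕ => (1/4 : ℝ) ^ k :=
      summable_geometric_of_lt_one (by norm_num) (by norm_num)
    have hu1 : ∀ t : ℝ, HasSum (fun k : ℕ => if k < ⌊t⌋₊ then (4:ℝ) else 0) (4 * ⌊t⌋₊) := by
      intro t
      have : HasSum (fun k : ℕ => if k < ⌊t⌋₊ then (4:ℝ) else 0)
          (∑ k ∈ Finset.range ⌊t⌋₊, if k < ⌊t⌋₊ then (4:ℝ) else 0) :=
        hasSum_sum_of_ne_finset_zero fun k hk => by
          rw [if_neg (by simpa using hk)]
      convert this using 1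
      rw [Finset.sum_congr rfl (g := fun _ => (4:ℝ))
        (fun k hk => if_pos (Finset.mem_range.1 hk))]
      simp [mul_comm]
    have hus : ∀ t : ℝ, HasSum (u t) (4 * ⌊t⌋₊ + ∑' k : ℕ, (1/4 : ℝ) ^ k) := fun t =>
      (hu1 t).add hgs.hasSum
    have hsum : ∀ n (x y : X n), Summable fun k => dist (φ k n x) (φ k n y) ^ 2 :=
      fun n x y => Summable.of_nonneg_of_le (fun k => sq_nonneg _) (hle n x y) (hus _).summable
    choose L l1 l2 l3 F hF using fun n =>
      exists_sum_embedding (fun k => H k n) (fun k => φ k n) (hsum n)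
    let S : ℝ → Finset ℕ := fun t => (Finset.range ⌊t⌋₊).filter fun k => M k ≤ t
    have hS : Monotone S := by
      intro s t hst k hk
      simp only [S, Finset.mem_filter, Finset.mem_range] at hk ⊢
      exact ⟨hk.1.trans_le (Nat.floor_mono hst), hk.2.trans hst⟩
    refine ⟨L, l1, l2, l3, F, fun t => √((S t).card : ℝ),
      fun t => √(4 * ⌊t⌋₊ + ∑' k : ℕ, (1/4 : ℝ) ^ k), ?_, ?_, ?_, ?_⟩
    · intro s t hst
      apply Real.sqrt_le_sqrt
      exact_mod_cast Finset.card_le_card (hS hst)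
    · intro s t hst
      apply Real.sqrt_le_sqrt
      have : (⌊s⌋₊ : ℝ) ≤ ⌊t⌋₊ := by exact_mod_cast Nat.floor_mono hst
      linarith
    · apply Real.tendsto_sqrt_atTop.comp
      apply tendsto_natCast_atTop_atTop.comp
      rw [Filter.tendsto_atTop]
      intro N
      have h1 : ∀ᶠ t in Filter.atTop, ∀ k ∈ Finset.range N, M k ≤ t :=
        (Filter.eventually_all_finset _).2 fun k _ => Filter.eventually_ge_atTop (M k)
      filter_upwards [h1, Filter.eventually_ge_atTop (N : ℝ)] with t ht htN
      have : Finset.range N ⊆ S t := by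
        intro k hk
        simp only [S, Finset.mem_filter, Finset.mem_range]
        exact ⟨(Finset.mem_range.1 hk).trans_le (Nat.le_floor htN), ht k hk⟩
      simpa using Finset.card_le_card this
    · intro n x y
      constructor
      · apply Real.sqrt_le_iff.2 ⟨dist_nonneg, ?_⟩
        rw [hF]
        calc ((S (dist x y)).card : ℝ) = ∑ k ∈ S (dist x y), (1:ℝ) := by simp
          _ ≤ ∑ k ∈ S (dist x y), dist (φ k n x) (φ k n y) ^ 2 := by
            refine Finset.sum_le_sum fun k hk => ?_
            have hk2 := hM k n x y (Finset.mem_filter.1 hk).2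
            have h3 := dist_sq_unit _ _ (hu k n x) (hu k n y)
            rw [h3]
            linarith [(abs_le.1 hk2).2]
          _ ≤ _ := (hsum n x y).sum_le_tsum _ fun k _ => sq_nonneg _
      · apply Real.le_sqrt_of_sq_le
        rw [hF]
        exact (hsum n x y).tsum_le_of_sum_le (fun s => 
          (Finset.sum_le_sum fun k _ => hle n x y k).trans
            ((hus (dist x y)).summable.sum_le_tsum s (fun k _ => (sq_nonneg _).trans (hle n x y k))
              |>.trans_eq (hus (dist x y)).tsum_eq))
end

section
/- Let G be an amenable group with proper length function ℓ, and let (N_n)_{n∈ℕ} be a sequence of finite-index normal subgroups of G with trivial intersection. Then the sequence of finite quotient groups (G/N_n)_{n∈ℕ}, each equipped with the metric coming from the quotient length induced by ℓ, is equi-exact. -/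
lemma reiter_finite {G : Type*} [Group G] (hG : ReiterAmenable G) (F : Finset G) (ε : ℝ)
    (hε : 0 < ε) : ∃ (T : Finset G) (f : G → ℝ), (∀ x, 0 ≤ f x) ∧ (∀ x, x ∉ T → f x = 0) ∧
      ∑ x ∈ T, f x = 1 ∧ ∀ h ∈ F, ∀ U : Finset G, ∑ u ∈ U, |f (h⁻¹ * u) - f u| ≤ ε := by
  classical
  obtain ⟨ξ, hs, h1, hF⟩ := hG F (ε / 4) (by positivity)
  have hle : ∀ U : Finset G, ∑ x ∈ U, ξ x ^ 2 ≤ 1 := fun U => by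
    rw [← h1]; exact hs.sum_le_tsum U (fun _ _ => sq_nonneg _)
  have hsum : HasSum (fun x => ξ x ^ 2) 1 := h1 ▸ hs.hasSum
  have hev : ∀ᶠ U : Finset G in Filter.atTop, 1 - ε / 8 < ∑ x ∈ U, ξ x ^ 2 :=
    hsum.eventually (lt_mem_nhds (by linarith))
  obtain ⟨T, hT, hT1⟩ := (hev.and (Filter.eventually_ge_atTop ({1} : Finset G))).exists
  have h1T : (1 : G) ∈ T := hT1 (by simp)
  have hcle := hle T
  set c : ℝ := 1 - ∑ x ∈ T, ξ x ^ 2 with hc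
  have hc0 : 0 ≤ c := by linarith
  have hc1 : c ≤ ε / 8 := by linarith
  let f : G → ℝ := fun u => (if u ∈ T then ξ u ^ 2 else 0) + (if u = 1 then c else 0)
  have hdiff : ∀ V : Finset G, ∑ u ∈ V, |f u - ξ u ^ 2| ≤ ε / 4 := by
    intro V
    have hp : ∀ u ∈ V, |f u - ξ u ^ 2| ≤
        (if u ∉ T then ξ u ^ 2 else 0) + (if u = 1 then c else 0) := by
      intro u _
      have := sq_nonneg (ξ u)
      by_cases hu : u ∈ T <;> by_cases hu1 : u = 1 <;>
        simp only [f, hu, hu1, if_true, if_false, not_true, not_false_eq_true] <;>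
        rw [abs_le] <;> constructor <;> first | linarith | (subst hu1; exact absurd h1T hu) | skip
      all_goals (try subst hu1); simp [h1T]; try linarith
    refine (Finset.sum_le_sum hp).trans ?_
    rw [Finset.sum_add_distrib, ← Finset.sum_filter]
    have ha : ∑ u ∈ V.filter (· ∉ T), ξ u ^ 2 ≤ c := by
      have := hle (T ∪ V.filter (· ∉ T))
      rw [Finset.sum_union] at this
      · linarith
      · rw [Finset.disjoint_left]; intro a ha hb
        exact (Finset.mem_filter.1 hb).2 ha
    have hb : ∑ u ∈ V, (if u = 1 then c else 0) ≤ c := by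
      rw [Finset.sum_ite_eq']; split_ifs <;> linarith
    linarith
  have hshift : ∀ (h : G) (U : Finset G) (k : G → ℝ),
      ∑ u ∈ U, k (h⁻¹ * u) = ∑ u ∈ U.image (fun u => h⁻¹ * u), k u := by
    intro h U k
    rw [Finset.sum_image]
    intro a _ b _ hab
    exact mul_left_cancel hab
  refine ⟨T, f, ?_, ?_, ?_, ?_⟩
  · intro x
    have := sq_nonneg (ξ x)
    simp only [f]; split_ifs <;> linarith
  · intro x hx
    have : x ≠ 1 := fun h => hx (h ▸ h1T)
    simp [f, hx, this]
  · simp only [f]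
    rw [Finset.sum_add_distrib, Finset.sum_ite_eq', if_pos h1T, Finset.sum_ite_mem,
      Finset.inter_self]
    linarith
  · intro h hh U
    have hs' : Summable (fun x => ξ (h⁻¹ * x) ^ 2) :=
      (Equiv.mulLeft h⁻¹).summable_iff.2 hs
    have hsd : Summable (fun x => (ξ (h⁻¹ * x) - ξ x) ^ 2) := by
      refine Summable.of_nonneg_of_le (fun _ => sq_nonneg _) (fun x => ?_)
        ((hs'.mul_left 2).add (hs.mul_left 2))
      nlinarith [sq_nonneg (ξ (h⁻¹ * x) + ξ x)]
    have hA : ∑ x ∈ U, (ξ (h⁻¹ * x) - ξ x) ^ 2 ≤ (ε / 4) ^ 2 :=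
      (hsd.sum_le_tsum U (fun _ _ => sq_nonneg _)).trans (hF h hh)
    have hB : ∑ x ∈ U, (ξ (h⁻¹ * x) + ξ x) ^ 2 ≤ 4 := by
      have e1 := hle U
      have e2 := hle (U.image (fun u => h⁻¹ * u))
      rw [← hshift h U (fun u => ξ u ^ 2)] at e2
      have : ∑ x ∈ U, (ξ (h⁻¹ * x) + ξ x) ^ 2 ≤
          ∑ x ∈ U, (2 * ξ (h⁻¹ * x) ^ 2 + 2 * ξ x ^ 2) :=
        Finset.sum_le_sum fun x _ => by nlinarith [sq_nonneg (ξ (h⁻¹ * x) - ξ x)]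
      rw [Finset.sum_add_distrib, ← Finset.mul_sum, ← Finset.mul_sum] at this
      linarith
    have hM : ∑ u ∈ U, |ξ (h⁻¹ * u) ^ 2 - ξ u ^ 2| ≤ ε / 2 := by
      have cs := Finset.sum_mul_sq_le_sq_mul_sq U (fun u => |ξ (h⁻¹ * u) - ξ u|)
        (fun u => |ξ (h⁻¹ * u) + ξ u|)
      simp only [sq_abs, ← abs_mul] at cs
      have e : ∀ u, (ξ (h⁻¹ * u) - ξ u) * (ξ (h⁻¹ * u) + ξ u) = ξ (h⁻¹ * u) ^ 2 - ξ u ^ 2 :=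
        fun u => by ring
      simp only [e] at cs
      refine le_of_sq_le_sq ?_ (by positivity)
      refine cs.trans ((mul_le_mul hA hB (Finset.sum_nonneg fun _ _ => sq_nonneg _)
        (by positivity)).trans (le_of_eq (by ring)))
    have d1 := hdiff U
    have d2 := hdiff (U.image (fun u => h⁻¹ * u))
    rw [← hshift h U (fun u => |f u - ξ u ^ 2|)] at d2
    have : ∑ u ∈ U, |f (h⁻¹ * u) - f u| ≤ ∑ u ∈ U, (|f (h⁻¹ * u) - ξ (h⁻¹ * u) ^ 2| +
        |ξ (h⁻¹ * u) ^ 2 - ξ u ^ 2| + |f u - ξ u ^ 2|) := by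
      refine Finset.sum_le_sum fun u _ => ?_
      have := abs_sub_le (f (h⁻¹ * u)) (ξ (h⁻¹ * u) ^ 2) (f u)
      have := abs_sub_le (ξ (h⁻¹ * u) ^ 2) (ξ u ^ 2) (f u)
      rw [abs_sub_comm (ξ u ^ 2)] at this
      linarith
    rw [Finset.sum_add_distrib, Finset.sum_add_distrib] at this
    linarith

/-- The box space of an amenable group is equi-exact. -/
theorem statement13 {G : Type*} [Group G] (hG : ReiterAmenable G)
    (ℓ : G → ℝ) (hℓ : IsProperLength ℓ)
    (N : ℕ → Subgroup G) (hNn : ∀ n, (N n).Normal) (hNfi : ∀ n, (N n).FiniteIndex)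
    (hNint : (⨅ n, N n) = ⊥) :
    EquiExact (fun n => G ⧸ N n) (fun n => quotDist ℓ (N n)) := by
  classical
  intro R hR ε hε
  obtain ⟨hl, hp⟩ := hℓ
  obtain ⟨T, f, f0, fT, f1, fF⟩ := reiter_finite hG (hp (R + 1)).toFinset ε hε
  have hS0 : 0 ≤ ∑ t ∈ T, ℓ t := Finset.sum_nonneg fun t _ => hl.nonneg t
  have hS : ∀ t ∈ T, ℓ t ≤ ∑ t ∈ T, ℓ t := fun t ht =>
    Finset.single_le_sum (f := ℓ) (fun i _ => hl.nonneg i) ht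
  refine ⟨2 * (∑ t ∈ T, ℓ t) + 1, by linarith, fun n => ?_⟩
  haveI := hNn n
  haveI := hNfi n
  haveI : Fintype (G ⧸ N n) := Fintype.ofFinite _
  let e := Fintype.equivFin (G ⧸ N n)
  let φ : Fin (Fintype.card (G ⧸ N n)) → G ⧸ N n → ℝ :=
    fun i x => ∑ t ∈ T, if e (x * (t : G ⧸ N n)) = i then f t else 0
  have hφ0 : ∀ i x, 0 ≤ φ i x := fun i x => Finset.sum_nonneg fun t _ => by
    split_ifs
    exacts [f0 t, le_rfl]
  refine ⟨Fin (Fintype.card (G ⧸ N n)), φ, ?_, ?_, ?_, ?_⟩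
  · refine fun i x => ⟨hφ0 i x, ?_⟩
    rw [← f1]
    refine Finset.sum_le_sum fun t _ => ?_
    split_ifs
    exacts [le_rfl, f0 t]
  · intro x
    have : ∑ i, φ i x = 1 := by
      simp only [φ]
      rw [Finset.sum_comm, ← f1]
      refine Finset.sum_congr rfl fun t _ => ?_
      simp
    rw [← this]
    exact hasSum_fintype _
  · intro x y hxy
    refine ⟨_, ?_, hasSum_fintype _⟩
    have hne : {r : ℝ | ∃ g h : G, QuotientGroup.mk g = x ∧ QuotientGroup.mk h = y ∧
        ℓ (g⁻¹ * h) = r}.Nonempty := by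
      obtain ⟨g, rfl⟩ := QuotientGroup.mk_surjective x
      obtain ⟨h, rfl⟩ := QuotientGroup.mk_surjective y
      exact ⟨_, g, h, rfl, rfl, rfl⟩
    have hlt : sInf {r : ℝ | ∃ g h : G, QuotientGroup.mk g = x ∧ QuotientGroup.mk h = y ∧
        ℓ (g⁻¹ * h) = r} < R + 1 := lt_of_le_of_lt hxy (by linarith)
    obtain ⟨r, ⟨g, k, rfl, rfl, rfl⟩, hr⟩ := exists_lt_of_csInf_lt hne hlt
    set h := g⁻¹ * k with hh
    have hk : (k : G ⧸ N n) = (g : G ⧸ N n) * (h : G ⧸ N n) := by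
      rw [← QuotientGroup.mk_mul, hh, mul_inv_cancel_left]
    set U := T ∪ T.image (fun t => h * t) with hU
    have key1 : ∀ i, φ i (g : G ⧸ N n) =
        ∑ u ∈ U, if e ((g : G ⧸ N n) * (u : G ⧸ N n)) = i then f u else 0 := by
      intro i
      refine Finset.sum_subset Finset.subset_union_left fun u _ hu => ?_
      simp [fT u hu]
    have key2 : ∀ i, φ i (k : G ⧸ N n) =
        ∑ u ∈ U, if e ((g : G ⧸ N n) * (u : G ⧸ N n)) = i then f (h⁻¹ * u) else 0 := by
      intro i
      rw [← Finset.sum_subset (Finset.subset_union_right (s₁ := T)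
        (s₂ := T.image (fun t => h * t)))]
      · rw [Finset.sum_image (fun a _ b _ hab => mul_left_cancel hab)]
        refine Finset.sum_congr rfl fun t _ => ?_
        have e3 : (g : G ⧸ N n) * ((h * t : G) : G ⧸ N n) = (k : G ⧸ N n) * (t : G ⧸ N n) := by
          rw [hk]; exact (mul_assoc (g : G ⧸ N n) (h : G ⧸ N n) (t : G ⧸ N n)).symm
        rw [e3, inv_mul_cancel_left]
      · intro u _ hu
        have : h⁻¹ * u ∉ T := fun hc => hu (Finset.mem_image.2 ⟨_, hc, by simp⟩)
        simp [fT _ this]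
    refine le_trans ?_ (fF h (by simpa using hr.le) U)
    calc ∑ i, |φ i (g : G ⧸ N n) - φ i (k : G ⧸ N n)|
        ≤ ∑ i, ∑ u ∈ U, (if e ((g : G ⧸ N n) * (u : G ⧸ N n)) = i
            then |f (h⁻¹ * u) - f u| else 0) := by
          refine Finset.sum_le_sum fun i _ => ?_
          rw [key1, key2, ← Finset.sum_sub_distrib]
          refine (Finset.abs_sum_le_sum_abs _ _).trans (Finset.sum_le_sum fun u _ => ?_)
          split_ifs
          · rw [abs_sub_comm]
          · simp
      _ = ∑ u ∈ U, |f (h⁻¹ * u) - f u| := by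
          rw [Finset.sum_comm]
          refine Finset.sum_congr rfl fun t _ => ?_
          simp
  · intro i x y hx hy
    obtain ⟨s, hs, hs'⟩ := Finset.exists_ne_zero_of_sum_ne_zero hx
    obtain ⟨t, ht, ht'⟩ := Finset.exists_ne_zero_of_sum_ne_zero hy
    have es : e (x * (s : G ⧸ N n)) = i := by
      by_contra hc; simp [hc] at hs'
    have et : e (y * (t : G ⧸ N n)) = i := by
      by_contra hc; simp [hc] at ht'
    have exy := e.injective (es.trans et.symm)
    obtain ⟨g, rfl⟩ := QuotientGroup.mk_surjective x
    have hbd : BddBelow {r : ℝ | ∃ a b : G, QuotientGroup.mk a = (g : G ⧸ N n) ∧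
        QuotientGroup.mk b = y ∧ ℓ (a⁻¹ * b) = r} := by
      refine ⟨0, ?_⟩
      rintro r ⟨a, b, _, _, rfl⟩
      exact hl.nonneg _
    have hle : quotDist ℓ (N n) (g : G ⧸ N n) y ≤ ℓ (g⁻¹ * (g * (s * t⁻¹))) := by
      refine csInf_le hbd ⟨g, g * (s * t⁻¹), rfl, ?_, rfl⟩
      rw [QuotientGroup.mk_mul, QuotientGroup.mk_mul, QuotientGroup.mk_inv, ← mul_assoc, exy,
        mul_inv_cancel_right]
    rw [inv_mul_cancel_left] at hle
    have h1 := hl.subadd s t⁻¹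
    rw [hl.inv_eq] at h1
    have h2 := hS s hs
    have h3 := hS t ht
    show quotDist ℓ (N n) (g : G ⧸ N n) y ≤ _
    linarith
end

section
/- Let (X_n)_{n∈ℕ} be a sequence of metric spaces. Suppose that for every R > 0 and ε > 0 the following holds: for each n there exist an index set I_n and functions φ_{n,i} : X_n → [0,1] (i ∈ I_n) with Σ_{i∈I_n} φ_{n,i}(x) = 1 for all x ∈ X_n and Σ_{i∈I_n} |φ_{n,i}(x) − φ_{n,i}(y)| ≤ ε whenever d(x,y) ≤ R, such that moreover the family of subspaces (U_{n,i})_{n∈ℕ, i∈I_n}, where U_{n,i} = {x ∈ X_n : φ_{n,i}(x) ≠ 0} carries the metric inherited from X_n, coarsely embeds uniformly into Hilbert space (with control functions that may depend on R and ε). Then the sequence (X_n) coarsely embeds uniformly into Hilbert space. -/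
/-- A kernel represented by square-summable real coordinates indexed by a small type. -/
def KerRep {X : Type*} (k : X → X → ℝ) : Prop :=
  ∃ (J : Type) (f : X → J → ℝ), ∀ x y, HasSum (fun j => f x j * f y j) (k x y)

lemma hasSum_of_forall_eq {J : Type*} {f g : J → ℝ} {a : ℝ} (h : ∀ j, f j = g j)
    (hg : HasSum g a) : HasSum f a := by
  rw [funext h]
  exact hg

lemma KerRep.one {X : Type*} : KerRep (fun _ _ : X => (1:ℝ)) :=
  ⟨Unit, fun _ _ => 1, fun _ _ => by simpa using hasSum_unique (fun _ : Unit => (1:ℝ))⟩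

lemma KerRep.scale {X : Type*} {k : X → X → ℝ} (h : KerRep k) (g : X → ℝ) :
    KerRep (fun x y => g x * g y * k x y) := by
  obtain ⟨J, f, hf⟩ := h
  refine ⟨J, fun x j => g x * f x j, fun x y => ?_⟩
  exact hasSum_of_forall_eq (fun j => by ring) ((hf x y).mul_left (g x * g y))

lemma KerRep.comp {X Y : Type*} {k : X → X → ℝ} (h : KerRep k) (g : Y → X) :
    KerRep (fun x y => k (g x) (g y)) := by
  obtain ⟨J, f, hf⟩ := h
  exact ⟨J, fun x j => f (g x) j, fun x y => hf _ _⟩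

lemma KerRep.ext_zero {X : Type*} {p : X → Prop} {k : {x // p x} → {x // p x} → ℝ}
    (h : KerRep k) (e : X → X → ℝ) (he : ∀ x y (hx : p x) (hy : p y), e x y = k ⟨x, hx⟩ ⟨y, hy⟩)
    (he0 : ∀ x y, ¬ (p x ∧ p y) → e x y = 0) : KerRep e := by
  classical
  obtain ⟨J, f, hf⟩ := h
  refine ⟨J, fun x j => if hx : p x then f ⟨x, hx⟩ j else 0, fun x y => ?_⟩
  by_cases hx : p x
  · by_cases hy : p y
    · simpa [hx, hy, he x y hx hy] using hf ⟨x, hx⟩ ⟨y, hy⟩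
    · simpa [hx, hy, he0 x y (by tauto)] using (hasSum_zero : HasSum (fun _ : J => (0:ℝ)) 0)
  · simpa [hx, he0 x y (by tauto)] using (hasSum_zero : HasSum (fun _ : J => (0:ℝ)) 0)

lemma summable_mul_of_sq {J : Type*} {f g : J → ℝ} (hf : Summable (fun j => f j * f j))
    (hg : Summable (fun j => g j * g j)) : Summable (fun j => f j * g j) := by
  refine Summable.of_norm_bounded (hf.add hg) fun j => ?_
  rw [Real.norm_eq_abs, abs_le]
  constructor <;> nlinarith [sq_nonneg (f j + g j), sq_nonneg (f j - g j), mul_self_nonneg (f j), mul_self_nonneg (g j)]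

lemma KerRep.mul {X : Type*} {k l : X → X → ℝ} (h : KerRep k) (h' : KerRep l) :
    KerRep (fun x y => k x y * l x y) := by
  obtain ⟨J, f, hf⟩ := h
  obtain ⟨L, g, hg⟩ := h'
  refine ⟨J × L, fun x j => f x j.1 * g x j.2, fun x y => ?_⟩
  have h1 := (hf x y).mul (hg x y)
    (summable_mul_of_summable_norm (hf x y).summable.norm (hg x y).summable.norm)
  exact hasSum_of_forall_eq (fun j => by ring) h1

lemma KerRep.pow {X : Type*} {k : X → X → ℝ} (h : KerRep k) (n : ℕ) :
    KerRep (fun x y => k x y ^ n) := by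
  induction n with
  | zero => simpa using KerRep.one
  | succ n ih => simpa [pow_succ] using ih.mul h

lemma KerRep.sum {X : Type*} {ι : Type} {k : ι → X → X → ℝ} {K : X → X → ℝ}
    (h : ∀ i, KerRep (k i)) (hK : ∀ x y, HasSum (fun i => k i x y) (K x y)) : KerRep K := by
  choose J f hf using h
  have h0 : ∀ x, Summable (fun p : Σ i, J i => f p.1 x p.2 * f p.1 x p.2) := fun x => by
    rw [summable_sigma_of_nonneg (fun p => mul_self_nonneg _)]
    refine ⟨fun i => (hf i x x).summable, ?_⟩
    simpa only [(hf _ x x).tsum_eq] using (hK x x).summable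
  refine ⟨Σ i, J i, fun x p => f p.1 x p.2, fun x y => ?_⟩
  have hs := summable_mul_of_sq (h0 x) (h0 y)
  have h2 := hs.hasSum.sigma (fun i => hf i x y)
  rw [← h2.unique (hK x y)]
  exact hs.hasSum

lemma KerRep.exp {X : Type*} {k : X → X → ℝ} (h : KerRep k) :
    KerRep (fun x y => Real.exp (k x y)) := by
  refine KerRep.sum (k := fun (n : ℕ) x y => k x y ^ n / n.factorial) (fun n => ?_) fun x y => ?_
  · convert (h.pow n).scale (fun _ => Real.sqrt (1 / n.factorial)) using 3
    rw [Real.mul_self_sqrt (by positivity)]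
    ring
  · rw [Real.exp_eq_exp_ℝ]
    have h1 := NormedSpace.exp_series_hasSum_exp' (𝕂 := ℝ) (k x y)
    exact hasSum_of_forall_eq (fun n => by rw [smul_eq_mul, div_eq_inv_mul]) h1

lemma KerRep.inner_ker {H : Type} [NormedAddCommGroup H] [InnerProductSpace ℝ H] [CompleteSpace H] :
    KerRep (fun x y : H => inner ℝ x y) := by
  obtain ⟨w, b, hb⟩ := exists_hilbertBasis ℝ H
  refine ⟨w, fun x j => inner ℝ x (b j), fun x y => ?_⟩
  exact hasSum_of_forall_eq (fun j => by simp only [real_inner_comm (b j) y]) (b.hasSum_inner_mul_inner x y)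

lemma KerRep.gauss {H : Type} [NormedAddCommGroup H] [InnerProductSpace ℝ H] [CompleteSpace H]
    (t : ℝ) (ht : 0 ≤ t) : KerRep (fun x y : H => Real.exp (-(t * dist x y ^ 2))) := by
  have h1 := ((KerRep.inner_ker (H := H)).scale (fun _ => Real.sqrt (2 * t))).exp.scale
    (fun x => Real.exp (-(t * ‖x‖ ^ 2)))
  convert h1 using 3 with x y
  rw [Real.mul_self_sqrt (by positivity), ← Real.exp_add, ← Real.exp_add, dist_eq_norm,
    norm_sub_sq_real]
  congr 1
  ring

lemma KerRep.embed {X : Type*} {K : ℕ → X → X → ℝ} (h : ∀ k, KerRep (K k))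
    (h1 : ∀ k x, K k x x = 1) (hs : ∀ x y, Summable (fun k => 2 - 2 * K k x y)) :
    ∃ (J : Type) (F : X → lp (fun _ : J => ℝ) 2),
      ∀ x y, HasSum (fun k => 2 - 2 * K k x y) (dist (F x) (F y) ^ 2) := by
  choose J f hf using h
  have key : ∀ k x y, HasSum (fun j => (f k x j - f k y j) ^ 2) (2 - 2 * K k x y) := by
    intro k x y
    have := ((hf k x x).add (hf k y y)).sub ((hf k x y).mul_left 2)
    rw [h1, h1] at this
    rw [one_add_one_eq_two] at this
    exact hasSum_of_forall_eq (fun j => by ring) this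
  have key2 : ∀ x y, Summable
      (fun p : Σ k, J k => (f p.1 x p.2 - f p.1 y p.2) ^ 2) := fun x y => by
    rw [summable_sigma_of_nonneg (fun p => sq_nonneg _)]
    refine ⟨fun i => (key i x y).summable, ?_⟩
    simpa only [(key _ x y).tsum_eq] using hs x y
  refine ⟨Σ k, J k, ?_⟩
  rcases isEmpty_or_nonempty X with hX | ⟨⟨x0⟩⟩
  · exact ⟨fun x => hX.elim x, fun x => hX.elim x⟩
  have hm : ∀ x, Memℓp (fun p : Σ k, J k => f p.1 x p.2 - f p.1 x0 p.2) 2 := fun x => by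
    refine memℓp_gen ?_
    simpa using key2 x x0
  refine ⟨fun x => ⟨fun p => f p.1 x p.2 - f p.1 x0 p.2, hm x⟩, fun x y => ?_⟩
  have h3 := (key2 x y).hasSum.sigma (fun k => key k x y)
  convert h3 using 1
  rw [dist_eq_norm]
  have h4 := lp.norm_rpow_eq_tsum (p := 2) (by norm_num)
    ((⟨fun p => f p.1 x p.2 - f p.1 x0 p.2, hm x⟩ : lp (fun _ : (Σ k, J k) => ℝ) 2) -
      ⟨fun p => f p.1 y p.2 - f p.1 x0 p.2, hm y⟩)
  simp only [ENNReal.toReal_ofNat, Real.rpow_two] at h4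
  refine h4.trans (tsum_congr fun p => ?_)
  rw [lp.coeFn_sub, Pi.sub_apply, Real.norm_eq_abs, sq_abs]
  congr 1
  ring

lemma gluing_kernel (X : ℕ → Type*) [∀ n, MetricSpace (X n)] (R ε : ℝ) (hε : 0 < ε)
    (I : ℕ → Type) (φ : ∀ n, I n → X n → ℝ)
    (hφ : ∀ n i x, 0 ≤ φ n i x ∧ φ n i x ≤ 1)
    (hsum : ∀ n (x : X n), HasSum (fun i => φ n i x) 1)
    (hvar : ∀ n (x y : X n), dist x y ≤ R →
          ∃ s ≤ ε, HasSum (fun i => |φ n i x - φ n i y|) s)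
    (hU : UnifCoarseEmbedHilbert
          (fun p : Σ n, I n => {x : X p.1 // φ p.1 p.2 x ≠ 0})
          (fun p a b => dist (a : X p.1) (b : X p.1))) :
    ∃ K : ∀ n, X n → X n → ℝ, (∀ n, KerRep (K n)) ∧ (∀ n x, K n x x = 1) ∧
      (∀ n x y, 0 ≤ K n x y ∧ K n x y ≤ 1) ∧ (∀ n x y, dist x y ≤ R → 1 - K n x y ≤ ε) ∧
      ∃ S : ℝ, ∀ n x y, S ≤ dist x y → K n x y ≤ 1 / 2 := by
  classical
  obtain ⟨H, iN, iI, iC, F, ρm, ρp, hρm, hρp, htend, hF⟩ := hU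
  set t : ℝ := ε / (2 * (ρp R ^ 2 + 1)) with ht_def
  have ht : 0 < t := by positivity
  have htR : t * ρp R ^ 2 ≤ ε / 2 := by
    rw [ht_def, div_mul_eq_mul_div, div_le_div_iff₀ (by positivity) (by positivity)]
    nlinarith
  let e : ∀ n, I n → X n → X n → ℝ := fun n i x y =>
    if hxy : φ n i x ≠ 0 ∧ φ n i y ≠ 0 then
      Real.exp (-(t * dist (F ⟨n, i⟩ ⟨x, hxy.1⟩) (F ⟨n, i⟩ ⟨y, hxy.2⟩) ^ 2)) else 0
  have he_rep : ∀ n i, KerRep (e n i) := fun n i => by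
    refine KerRep.ext_zero (p := fun x => φ n i x ≠ 0)
      ((KerRep.gauss (H := H ⟨n, i⟩) t ht.le).comp (F ⟨n, i⟩)) _ ?_ ?_
    · intro x y hx hy
      exact dif_pos ⟨hx, hy⟩
    · intro x y hxy
      exact dif_neg hxy
  have he0 : ∀ n i x y, 0 ≤ e n i x y := fun n i x y => by
    simp only [e]; split_ifs <;> positivity
  have he1 : ∀ n i x y, e n i x y ≤ 1 := fun n i x y => by
    simp only [e]; split_ifs
    · rw [Real.exp_le_one_iff]
      have : 0 ≤ t * dist (F ⟨n, i⟩ ⟨x, by tauto⟩) (F ⟨n, i⟩ ⟨y, by tauto⟩) ^ 2 := by positivity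
      linarith
    · norm_num
  let q : ∀ n, I n → X n → X n → ℝ := fun n i x y => √(φ n i x) * √(φ n i y)
  have hq0 : ∀ n i x y, 0 ≤ q n i x y := fun n i x y => by positivity
  have hq1 : ∀ n i x y, q n i x y ≤ (φ n i x + φ n i y) / 2 := fun n i x y => by
    have h1 := Real.sq_sqrt (hφ n i x).1
    have h2 := Real.sq_sqrt (hφ n i y).1
    simp only [q]
    nlinarith [sq_nonneg (√(φ n i x) - √(φ n i y))]
  have hq2 : ∀ n i x y, (φ n i x + φ n i y) / 2 - |φ n i x - φ n i y| / 2 ≤ q n i x y := by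
    intro n i x y
    have aux : ∀ a b : ℝ, 0 ≤ a → a ≤ b → (a + b) / 2 - |a - b| / 2 ≤ √a * √b := by
      intro a b ha hab
      rw [abs_of_nonpos (by linarith)]
      have := Real.mul_self_sqrt ha
      nlinarith [Real.sqrt_le_sqrt hab, Real.sqrt_nonneg a]
    rcases le_total (φ n i x) (φ n i y) with h | h
    · exact aux _ _ (hφ n i x).1 h
    · have := aux _ _ (hφ n i y).1 h
      simp only [q]
      rw [abs_sub_comm, mul_comm, add_comm]
      exact this
  have hhalf : ∀ n (x y : X n), HasSum (fun i => (φ n i x + φ n i y) / 2) 1 := fun n x y => by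
    have := ((hsum n x).add (hsum n y)).div_const 2
    norm_num at this
    exact this
  have hqe : ∀ n i x y, q n i x y * e n i x y ≤ q n i x y := fun n i x y =>
    mul_le_of_le_one_right (hq0 n i x y) (he1 n i x y)
  have hqs : ∀ n x y, Summable (fun i => q n i x y) := fun n x y =>
    Summable.of_nonneg_of_le (fun i => hq0 n i x y) (fun i => hq1 n i x y) (hhalf n x y).summable
  have hks : ∀ n x y, Summable (fun i => q n i x y * e n i x y) := fun n x y =>
    Summable.of_nonneg_of_le (fun i => mul_nonneg (hq0 n i x y) (he0 n i x y))
      (fun i => hqe n i x y) (hqs n x y)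
  refine ⟨fun n x y => ∑' i, q n i x y * e n i x y, ?_, ?_, ?_, ?_, ?_⟩
  · intro n
    exact KerRep.sum (k := fun i x y => q n i x y * e n i x y)
      (fun i => (he_rep n i).scale (fun x => √(φ n i x))) (fun x y => (hks n x y).hasSum)
  · intro n x
    rw [← (hsum n x).tsum_eq]
    refine tsum_congr fun i => ?_
    simp only [q, e, Real.mul_self_sqrt (hφ n i x).1]
    by_cases h0 : φ n i x = 0
    · simp [h0]
    · simp [h0]
  · intro n x y
    refine ⟨tsum_nonneg fun i => mul_nonneg (hq0 n i x y) (he0 n i x y), ?_⟩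
    exact hasSum_le (fun i => (hqe n i x y).trans (hq1 n i x y)) (hks n x y).hasSum (hhalf n x y)
  · intro n x y hxy
    obtain ⟨s, hs, hs'⟩ := hvar n x y hxy
    have hlow : ∀ i, (φ n i x + φ n i y) / 2 - |φ n i x - φ n i y| / 2
        - (ε / 2) * ((φ n i x + φ n i y) / 2) ≤ q n i x y * e n i x y := by
      intro i
      have h2 := hq2 n i x y
      have h1 := hq1 n i x y
      by_cases hxy' : φ n i x ≠ 0 ∧ φ n i y ≠ 0
      · have hee : 1 - ε / 2 ≤ e n i x y := by
          simp only [e, dif_pos hxy']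
          have hd := (hF ⟨n, i⟩ ⟨x, hxy'.1⟩ ⟨y, hxy'.2⟩).2.trans (hρp hxy)
          have hd2 := pow_le_pow_left₀ dist_nonneg hd 2
          have hd3 := mul_le_mul_of_nonneg_left hd2 ht.le
          have := Real.add_one_le_exp
            (-(t * dist (F ⟨n, i⟩ ⟨x, hxy'.1⟩) (F ⟨n, i⟩ ⟨y, hxy'.2⟩) ^ 2))
          linarith
        nlinarith [hq0 n i x y]
      · have hq : q n i x y = 0 := by
          simp only [q]
          by_cases hx : φ n i x = 0
          · simp [hx]
          · have hy : φ n i y = 0 := by tauto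
            simp [hy]
        rw [hq] at h2 ⊢
        have := (hφ n i x).1
        have := (hφ n i y).1
        have : 0 ≤ (ε / 2) * ((φ n i x + φ n i y) / 2) := by positivity
        linarith
    have := hasSum_le hlow (((hhalf n x y).sub (hs'.div_const 2)).sub
      ((hhalf n x y).mul_left (ε / 2))) (hks n x y).hasSum
    simp only
    linarith
  · obtain ⟨S, hS⟩ := Filter.eventually_atTop.1 (htend.eventually_ge_atTop (1 + 1 / t))
    refine ⟨S, fun n x y hxy => ?_⟩
    have hup : ∀ i, q n i x y * e n i x y ≤ (φ n i x + φ n i y) / 2 * (1 / 2) := by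
      intro i
      refine mul_le_mul (hq1 n i x y) ?_ (he0 n i x y) ((hq0 n i x y).trans (hq1 n i x y))
      simp only [e]
      split_ifs with hxy'
      · have hd := (hS _ hxy).trans (hF ⟨n, i⟩ ⟨x, hxy'.1⟩ ⟨y, hxy'.2⟩).1
        have hd2 := pow_le_pow_left₀ (by positivity) hd 2
        have hd3 := mul_le_mul_of_nonneg_left hd2 ht.le
        have h4 : 1 ≤ t * (1 + 1 / t) ^ 2 := by
          have : t * (1 + 1 / t) ^ 2 = t + 2 + 1 / t := by field_simp; ring
          rw [this]
          have : 0 < 1 / t := by positivity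
          linarith
        refine (Real.exp_le_exp.2 (by linarith : _ ≤ (-1:ℝ))).trans ?_
        rw [Real.exp_neg, one_div]
        refine inv_anti₀ (by norm_num) ?_
        have := Real.add_one_le_exp (1:ℝ)
        linarith
      · norm_num
    have := hasSum_le hup (hks n x y).hasSum ((hhalf n x y).mul_right (1 / 2))
    simpa using this

/-- Gluing lemma: if a sequence of metric spaces admits, for every `R`
and `ε`, `(R, ε)`-Lipschitz partitions of unity whose supports form a uniformly embeddable
family, then the sequence coarsely embeds uniformly into Hilbert space. -/
theorem statement14 (X : ℕ → Type*) [∀ n, MetricSpace (X n)]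
    (h : ∀ R > (0:ℝ), ∀ ε > (0:ℝ),
      ∃ (I : ℕ → Type) (φ : ∀ n, I n → X n → ℝ),
        (∀ n i x, 0 ≤ φ n i x ∧ φ n i x ≤ 1) ∧
        (∀ n (x : X n), HasSum (fun i => φ n i x) 1) ∧
        (∀ n (x y : X n), dist x y ≤ R →
          ∃ s ≤ ε, HasSum (fun i => |φ n i x - φ n i y|) s) ∧
        UnifCoarseEmbedHilbert
          (fun p : Σ n, I n => {x : X p.1 // φ p.1 p.2 x ≠ 0})
          (fun p a b => dist (a : X p.1) (b : X p.1))) :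
    UnifCoarseEmbedHilbert X (fun n (x y : X n) => dist x y) := by
  have h' : ∀ k : ℕ, ∃ K : ∀ n, X n → X n → ℝ, (∀ n, KerRep (K n)) ∧ (∀ n x, K n x x = 1) ∧
      (∀ n x y, 0 ≤ K n x y ∧ K n x y ≤ 1) ∧
      (∀ n x y, dist x y ≤ (k:ℝ) + 1 → 1 - K n x y ≤ (1 / 2) ^ k) ∧
      ∃ S : ℝ, ∀ n x y, S ≤ dist x y → K n x y ≤ 1 / 2 := fun k => by
    obtain ⟨I, φ, h1, h2, h3, h4⟩ := h ((k:ℝ) + 1) (by positivity) ((1 / 2) ^ k) (by positivity)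
    exact gluing_kernel X _ _ (by positivity) I φ h1 h2 h3 h4
  choose K hrep hK1 hK hKR S hS using h'
  have hg : HasSum (fun k : ℕ => 2 * (1 / 2 : ℝ) ^ k) 4 := by
    have := hasSum_geometric_two.mul_left (2:ℝ)
    norm_num at this ⊢
    exact this
  have hb : ∀ N : ℕ, HasSum (fun k : ℕ => if k ∈ Finset.range N then (2:ℝ) else 0) (2 * N) := by
    intro N
    have := hasSum_sum_of_ne_finset_zero (L := SummationFilter.unconditional ℕ) (s := Finset.range N)
      (f := fun k : ℕ => if k ∈ Finset.range N then (2:ℝ) else 0) (fun k hk => if_neg hk)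
    rw [Finset.sum_ite_mem, Finset.inter_self, Finset.sum_const, Finset.card_range,
      nsmul_eq_mul, mul_comm] at this
    exact this
  have hle : ∀ n (x y : X n) (k : ℕ), 2 - 2 * K k n x y ≤
      (if k ∈ Finset.range ⌈dist x y⌉₊ then (2:ℝ) else 0) + 2 * (1 / 2 : ℝ) ^ k := by
    intro n x y k
    have hp : (0:ℝ) < (1 / 2) ^ k := by positivity
    split_ifs with hk
    · linarith [(hK k n x y).1]
    · rw [Finset.mem_range, not_lt, Nat.ceil_le] at hk
      linarith [hKR k n x y (by linarith)]
  have hnn : ∀ n (x y : X n) (k : ℕ), 0 ≤ 2 - 2 * K k n x y := fun n x y k => by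
    linarith [(hK k n x y).2]
  have hsumm : ∀ n (x y : X n), Summable (fun k => 2 - 2 * K k n x y) := fun n x y =>
    Summable.of_nonneg_of_le (hnn n x y) (hle n x y) ((hb _).add hg).summable
  choose J F hF using fun n => KerRep.embed (K := fun k => K k n) (fun k => hrep k n)
    (fun k => hK1 k n) (hsumm n)
  refine ⟨fun n => lp (fun _ : J n => ℝ) 2, fun n => inferInstance, fun n => inferInstance,
    fun n => inferInstance, F,
    fun t => √(((Finset.range (⌊t⌋₊ + 1)).filter (fun k => S k ≤ t)).card : ℝ),
    fun t => √(2 * (⌈t⌉₊ : ℝ) + 4), ?_, ?_, ?_, ?_⟩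
  · intro a b hab
    refine Real.sqrt_le_sqrt (Nat.cast_le.2 (Finset.card_le_card ?_))
    intro k hk
    rw [Finset.mem_filter, Finset.mem_range] at hk ⊢
    have := Nat.floor_mono hab
    exact ⟨by omega, hk.2.trans hab⟩
  · intro a b hab
    have : (⌈a⌉₊ : ℝ) ≤ ⌈b⌉₊ := Nat.cast_le.2 (Nat.ceil_mono hab)
    exact Real.sqrt_le_sqrt (by linarith)
  · refine Real.tendsto_sqrt_atTop.comp (tendsto_natCast_atTop_atTop.comp ?_)
    rw [Filter.tendsto_atTop]
    intro m
    filter_upwards [Filter.eventually_ge_atTop (m:ℝ),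
      (Filter.eventually_all_finset (Finset.range m)).2
        (fun k _ => Filter.eventually_ge_atTop (S k))] with t ht1 ht2
    rw [← Finset.card_range m]
    refine Finset.card_le_card ?_
    intro k hk
    have := Nat.le_floor ht1
    rw [Finset.mem_filter, Finset.mem_range]
    exact ⟨by have := Finset.mem_range.1 hk; omega, ht2 k hk⟩
  · intro n x y
    constructor
    · refine Real.sqrt_le_iff.2 ⟨dist_nonneg, ?_⟩
      refine le_trans ?_ (sum_le_hasSum
        ((Finset.range (⌊dist x y⌋₊ + 1)).filter (fun k => S k ≤ dist x y))
        (fun k _ => hnn n x y k) (hF n x y))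
      rw [← nsmul_one]
      refine Finset.card_nsmul_le_sum _ _ _ fun k hk => ?_
      linarith [hS k n x y (Finset.mem_filter.1 hk).2]
    · refine Real.le_sqrt_of_sq_le ?_
      exact hasSum_le (hle n x y) (hF n x y) ((hb _).add hg)
end

section
/- For every integer m ≥ 1 let F_m be the free group of rank m, equipped with the word length of a fixed free basis. There exist, for every m ≥ 1, a sequence (N_{m,k})_{k∈ℕ} of subgroups of F_m such that: each N_{m,k} has finite index in F_m and is characteristic in F_m; for every k, N_{m,k+1} is a subgroup of N_{m,k} which is characteristic in N_{m,k}; ⋂_k N_{m,k} = {1}; and the doubly-indexed family of finite quotients (F_m/N_{m,k}) over all pairs (m,k) with k ≥ m ≥ 1, each equipped with the quotient length induced by the word length on F_m, coarsely embeds uniformly into Hilbert space (with a single pair of control functions for the whole family). -/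
/-- The standard symmetric free basis set of the free group on `Fin m`. -/
def freeBasisSet (m : ℕ) : Set (FreeGroup (Fin m)) :=
  {g | ∃ i : Fin m, g = FreeGroup.of i ∨ g = (FreeGroup.of i)⁻¹}


section AGS

set_option linter.unusedSectionVars false
set_option linter.unusedSimpArgs false

open FreeGroup

variable {α Q : Type} [Fintype α] [DecidableEq α] [Group Q]

/-- The edge of the Cayley graph crossed when reading the letter `s` at the vertex `q`. -/
def edgeAt (π : FreeGroup α →* Q) (q : Q) (s : α × Bool) : Q × α :=
  (if s.2 then q else q * (π (of s.1))⁻¹, s.1)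

open Classical in
/-- The Magnus homomorphism. -/
noncomputable def magnus (π : FreeGroup α →* Q) :
    FreeGroup α →* RegularWreathProduct (Multiplicative (α → ZMod 2)) Q :=
  FreeGroup.lift fun i =>
    ⟨fun q => if q = 1 then Multiplicative.ofAdd (Pi.single i 1) else 1, π (of i)⟩

/-- The mod 2 chain of edges crossed by the path labelled `g` starting at `a`. -/
noncomputable def chn (π : FreeGroup α →* Q) (a : Q) (g : FreeGroup α) : Q × α → ZMod 2 :=
  fun e => Multiplicative.toAdd ((magnus π g).left (a⁻¹ * e.1)) e.2

lemma magnus_right (π : FreeGroup α →* Q) (g : FreeGroup α) : (magnus π g).right = π g := by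
  have : (RegularWreathProduct.rightHom.comp (magnus π)) = π := by
    ext i
    simp [magnus]
  exact DFunLike.congr_fun this g

lemma chn_one (π : FreeGroup α →* Q) (a : Q) : chn π a 1 = 0 := by
  funext e
  simp [chn]

lemma chn_mul (π : FreeGroup α →* Q) (a : Q) (g h : FreeGroup α) :
    chn π a (g * h) = chn π a g + chn π (a * π g) h := by
  funext e
  simp [chn, magnus_right, mul_assoc]

lemma zmod2_add_self (x : ZMod 2) : x + x = 0 := CharTwo.add_self_eq_zero x

lemma fun2_add_self {E : Type} (v : E → ZMod 2) : v + v = 0 := by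
  funext e; exact zmod2_add_self _

lemma zmod2_ne (x : ZMod 2) : x ≠ 0 ↔ x = 1 := by
  revert x; decide

open Classical in
lemma chn_of (π : FreeGroup α →* Q) (a : Q) (i : α) :
    chn π a (of i) = Pi.single (a, i) 1 := by
  funext ⟨q, j⟩
  by_cases h : q = a
  · subst h
    simp [chn, magnus, Pi.single_apply]
  · have : a⁻¹ * q ≠ 1 := by
      intro h'; exact h (inv_mul_eq_one.1 h').symm
    simp [chn, magnus, Pi.single_apply, this, h]

open Classical in
lemma chn_letter (π : FreeGroup α →* Q) (a : Q) (s : α × Bool) :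
    chn π a (mk [s]) = Pi.single (edgeAt π a s) 1 := by
  obtain ⟨i, b⟩ := s
  cases b
  · have h1 : (mk [(i, false)] : FreeGroup α) = (of i)⁻¹ := rfl
    have h := chn_mul π a (of i)⁻¹ (of i)
    rw [inv_mul_cancel, chn_one, chn_of] at h
    rw [h1]
    have h2 := congrArg (· + Pi.single (a * π (of i)⁻¹, i) (1 : ZMod 2)) h
    simp only [add_assoc, fun2_add_self, zero_add, add_zero] at h2
    rw [← h2]
    simp [edgeAt]
  · exact chn_of π a i

lemma mk_cons' (s : α × Bool) (L : List (α × Bool)) : (mk (s :: L) : FreeGroup α) = mk [s] * mk L := by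
  simp [FreeGroup.mul_mk]

open Classical in
lemma chn_cons (π : FreeGroup α →* Q) (a : Q) (s : α × Bool) (L : List (α × Bool)) :
    chn π a (mk (s :: L)) = Pi.single (edgeAt π a s) 1 + chn π (a * π (mk [s])) (mk L) := by
  rw [mk_cons', chn_mul, chn_letter]

/-- The mod 2 boundary. -/
noncomputable def bdr (π : FreeGroup α →* Q) : (Q × α → ZMod 2) →+ (Q → ZMod 2) where
  toFun v q := ∑ i, (v (q, i) + v (q * (π (of i))⁻¹, i))
  map_zero' := by funext q; simp
  map_add' u v := by
    funext q
    simp only [Pi.add_apply, ← Finset.sum_add_distrib]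
    refine Finset.sum_congr rfl fun i _ => ?_
    ring

open Classical in
lemma bdr_single (π : FreeGroup α →* Q) (q : Q) (i : α) :
    bdr π (Pi.single (q, i) 1) = Pi.single q 1 + Pi.single (q * π (of i)) 1 := by
  funext x
  simp only [bdr, AddMonoidHom.coe_mk, ZeroHom.coe_mk, Pi.add_apply]
  rw [Finset.sum_eq_single i]
  · simp [Pi.single_apply, mul_inv_eq_iff_eq_mul]
  · intro j _ hj
    simp [Pi.single_apply, hj]
  · simp

open Classical in
lemma bdr_edge (π : FreeGroup α →* Q) (q : Q) (s : α × Bool) :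
    bdr π (Pi.single (edgeAt π q s) 1) = Pi.single q 1 + Pi.single (q * π (mk [s])) 1 := by
  obtain ⟨i, b⟩ := s
  cases b
  · have h1 : (mk [(i, false)] : FreeGroup α) = (of i)⁻¹ := rfl
    simp only [edgeAt]
    rw [h1]
    simp only [Bool.false_eq_true, if_false]
    rw [bdr_single, add_comm]
    simp
  · exact bdr_single π q i

open Classical in
lemma bdr_chn_mk (π : FreeGroup α →* Q) (a : Q) (L : List (α × Bool)) :
    bdr π (chn π a (mk L)) = Pi.single a 1 + Pi.single (a * π (mk L)) 1 := by
  induction L generalizing a with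
  | nil =>
    have : (mk [] : FreeGroup α) = 1 := rfl
    rw [this, chn_one]
    simp [fun2_add_self]
  | cons s L ih =>
    rw [chn_cons, map_add, ih, bdr_edge, mk_cons' s L, _root_.map_mul, ← mul_assoc, add_assoc,
      ← add_assoc (Pi.single (a * π (mk [s])) 1), fun2_add_self, zero_add]

open Classical in
lemma bdr_chn (π : FreeGroup α →* Q) (a : Q) (g : FreeGroup α) :
    bdr π (chn π a g) = Pi.single a 1 + Pi.single (a * π g) 1 := by
  have := bdr_chn_mk π a g.toWord
  rwa [mk_toWord] at this

/-- The size of the support. -/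
noncomputable def wt {E : Type} (v : E → ZMod 2) : ℕ := (Function.support v).ncard

lemma wt_add_le {E : Type} [Finite E] (u v : E → ZMod 2) : wt (u + v) ≤ wt u + wt v := by
  refine (Set.ncard_le_ncard (Function.support_add u v) (Set.toFinite _)).trans ?_
  exact Set.ncard_union_le _ _

lemma wt_single {E : Type} [DecidableEq E] (e : E) : wt (Pi.single e (1 : ZMod 2)) = 1 := by
  have : Function.support (Pi.single e (1 : ZMod 2)) = {e} := by
    ext x; simp [Pi.single_apply]
  rw [wt, this, Set.ncard_singleton]

lemma wt_remove {E : Type} [DecidableEq E] [Finite E] (v : E → ZMod 2) (e : E) (h : v e ≠ 0) :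
    wt (v + Pi.single e 1) + 1 = wt v := by
  have : Function.support (v + Pi.single e 1) = Function.support v \ {e} := by
    ext x
    by_cases hx : x = e
    · subst hx
      rw [zmod2_ne] at h
      simp [h, zmod2_add_self]
    · simp [Pi.single_apply, hx]
  rw [wt, this, wt]
  exact Set.ncard_sdiff_singleton_add_one h (Set.toFinite _)

lemma wt_eq_zero {E : Type} [Finite E] (v : E → ZMod 2) (h : wt v = 0) : v = 0 := by
  rw [wt, Set.ncard_eq_zero (Set.toFinite _)] at h
  exact Function.support_eq_empty_iff.1 h

lemma wt_chn_mk [Finite Q] (π : FreeGroup α →* Q) (a : Q) (L : List (α × Bool)) :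
    wt (chn π a (mk L)) ≤ L.length := by
  classical
  induction L generalizing a with
  | nil =>
    have : (mk [] : FreeGroup α) = 1 := rfl
    rw [this, chn_one]
    simp [wt]
  | cons s L ih =>
    rw [chn_cons]
    have := wt_add_le (Pi.single (edgeAt π a s) 1) (chn π (a * π (mk [s])) (mk L))
    rw [wt_single] at this
    have := ih (a * π (mk [s]))
    simp only [List.length_cons]
    omega

lemma wt_chn_le [Finite Q] (π : FreeGroup α →* Q) (a : Q) (g : FreeGroup α) :
    wt (chn π a g) ≤ g.norm := by
  have := wt_chn_mk π a g.toWord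
  rwa [mk_toWord] at this

lemma chn_base (π : FreeGroup α →* Q) (a : Q) (g : FreeGroup α) (e : Q × α) :
    chn π a g e = chn π 1 g (a⁻¹ * e.1, e.2) := by
  simp [chn]

lemma wt_chn_base (π : FreeGroup α →* Q) (a : Q) (g : FreeGroup α) :
    wt (chn π a g) = wt (chn π 1 g) := by
  let σ : Q × α ≃ Q × α := (Equiv.mulLeft a).prodCongr (Equiv.refl α)
  have : Function.support (chn π a g) = σ '' Function.support (chn π 1 g) := by
    ext e
    rw [Equiv.image_eq_preimage_symm]
    simp only [Function.mem_support, chn_base π a g, Set.mem_preimage]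
    rfl
  rw [wt, this, Set.ncard_image_of_injective _ σ.injective, wt]

open Classical in
lemma path_lemma [Finite Q] (π : FreeGroup α →* Q) (n : ℕ) (v : Q × α → ZMod 2) (a b : Q)
    (hn : wt v = n) (hv : bdr π v = Pi.single a 1 + Pi.single b 1) :
    ∃ h : FreeGroup α, a * π h = b ∧ h.norm + wt (v + chn π a h) ≤ wt v ∧
      ∀ e, v e = 0 → chn π a h e = 0 := by
  induction n generalizing v a with
  | zero =>
    have h0 := wt_eq_zero v hn
    subst h0
    have hab : a = b := by
      by_contra hab
      have := congrFun hv a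
      simp [Pi.single_apply, hab] at this
    exact ⟨1, by simpa using hab, by simp [chn_one], by simp [chn_one]⟩
  | succ n ih =>
    by_cases hab : a = b
    · exact ⟨1, by simpa using hab, by simp [chn_one], by simp [chn_one]⟩
    have ha : bdr π v a ≠ 0 := by
      rw [hv]
      simp [Pi.single_apply, hab]
    have : ∃ s, v (edgeAt π a s) ≠ 0 := by
      by_contra hcon
      push Not at hcon
      apply ha
      simp only [bdr, AddMonoidHom.coe_mk, ZeroHom.coe_mk]
      refine Finset.sum_eq_zero fun i _ => ?_
      have h1 := hcon (i, true)
      have h2 := hcon (i, false)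
      simp only [edgeAt, if_true, Bool.false_eq_true, if_false] at h1 h2
      rw [h1, h2, add_zero]
    obtain ⟨s, hs⟩ := this
    have hw := wt_remove v _ hs
    obtain ⟨h, h1, h2, h3⟩ := ih (v + Pi.single (edgeAt π a s) 1) (a * π (mk [s])) (by omega) (by
      rw [map_add, hv, bdr_edge, add_comm (Pi.single a 1) (Pi.single b 1), add_assoc,
        ← add_assoc (Pi.single a 1), fun2_add_self, zero_add, add_comm])
    refine ⟨mk [s] * h, by rw [_root_.map_mul, ← mul_assoc, h1], ?_, ?_⟩
    · rw [chn_mul, chn_letter, ← add_assoc]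
      have := norm_mul_le (mk [s]) h
      have h4 : (mk [s] : FreeGroup α).norm ≤ 1 := norm_mk_le
      omega
    · intro e he
      have hne : e ≠ edgeAt π a s := by rintro rfl; exact hs he
      rw [chn_mul, chn_letter, Pi.add_apply, h3 e (by simp [he, hne])]
      simp [hne]

lemma cycle_lemma [Finite Q] (π : FreeGroup α →* Q) (v : Q × α → ZMod 2)
    (hv : bdr π v = 0) (hne : v ≠ 0) :
    ∃ h : FreeGroup α, π h = 1 ∧ h ≠ 1 ∧ h.norm ≤ wt v := by
  classical
  obtain ⟨⟨q, i⟩, he⟩ := Function.ne_iff.1 hne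
  have he : v (q, i) ≠ 0 := he
  obtain ⟨h, h1, h2, h3⟩ := path_lemma π _ (v + Pi.single (q, i) 1) (q * π (of i)) q rfl (by
    rw [map_add, hv, zero_add, bdr_single, add_comm])
  have hw := wt_remove v _ he
  refine ⟨of i * h, ?_, ?_, ?_⟩
  · rw [mul_assoc, ← _root_.map_mul] at h1
    simpa using h1
  · intro h5
    have h6 : chn π q (of i * h) (q, i) = 1 := by
      rw [chn_mul, chn_of, Pi.add_apply, h3 _ (by
        rw [zmod2_ne] at he; simp [he, zmod2_add_self])]
      simp
    rw [h5, chn_one] at h6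
    simp at h6
  · have := norm_mul_le (of i) h
    rw [norm_of] at this
    omega

lemma short_rep [Finite Q] (π : FreeGroup α →* Q) (G : ℕ)
    (hG : ∀ h, π h = 1 → h ≠ 1 → G ≤ h.norm) (g : FreeGroup α) (hg : wt (chn π 1 g) < G) :
    ∃ h, π h = π g ∧ chn π 1 h = chn π 1 g ∧ h.norm ≤ wt (chn π 1 g) := by
  classical
  obtain ⟨h, h1, h2, -⟩ := path_lemma π _ (chn π 1 g) 1 (π g) rfl (by rw [bdr_chn, one_mul])
  rw [one_mul] at h1
  refine ⟨h, h1, ?_, by omega⟩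
  have h0 : chn π 1 g + chn π 1 h = 0 := by
    by_contra hne
    obtain ⟨z, z1, z2, z3⟩ := cycle_lemma π _ (by
      rw [map_add, bdr_chn, bdr_chn, h1, fun2_add_self]) hne
    have := hG z z1 z2
    omega
  have := congrArg (· + chn π 1 h) h0
  simp only [add_assoc, fun2_add_self, add_zero, zero_add] at this
  exact this.symm

lemma exists_cross (π : FreeGroup α →* Q) (a : Q) (L : List (α × Bool)) (e : Q × α)
    (h : chn π a (mk L) e ≠ 0) :
    ∃ L1 t L2, L = L1 ++ t :: L2 ∧ edgeAt π (a * π (mk L1)) t = e := by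
  classical
  induction L generalizing a with
  | nil =>
    have : (mk [] : FreeGroup α) = 1 := rfl
    rw [this, chn_one] at h
    simp at h
  | cons s L ih =>
    by_cases hs : edgeAt π a s = e
    · refine ⟨[], s, L, rfl, ?_⟩
      have : (mk [] : FreeGroup α) = 1 := rfl
      rw [this, _root_.map_one, mul_one, hs]
    · rw [chn_cons, Pi.add_apply, Pi.single_eq_of_ne (Ne.symm hs), zero_add] at h
      obtain ⟨L1, t, L2, h1, h2⟩ := ih _ h
      refine ⟨s :: L1, t, L2, by rw [h1]; rfl, ?_⟩
      rw [mk_cons', _root_.map_mul, ← mul_assoc, h2]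

lemma mk_ne_one_of_reduced {L : List (α × Bool)} (h : IsReduced L) (hL : L ≠ []) :
    (mk L : FreeGroup α) ≠ 1 := by
  intro h1
  rw [← toWord_eq_nil_iff, toWord_mk, h.reduce_eq] at h1
  exact hL h1

lemma girth_step (π : FreeGroup α →* Q) (G : ℕ)
    (hG : ∀ h, π h = 1 → h ≠ 1 → G ≤ h.norm) (g : FreeGroup α) (hg : chn π 1 g = 0)
    (hne : g ≠ 1) : G + 1 ≤ g.norm := by
  classical
  have hred : IsReduced g.toWord := isReduced_toWord
  have hmk : mk g.toWord = g := mk_toWord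
  have hnorm : g.norm = g.toWord.length := rfl
  rw [hnorm]
  rcases hL : g.toWord with _ | ⟨s, L⟩
  · exact absurd (toWord_eq_nil_iff.1 hL) hne
  rw [hL] at hred hmk
  rw [← hmk, chn_cons] at hg
  have h1 : chn π (1 * π (mk [s])) (mk L) (edgeAt π 1 s) ≠ 0 := by
    intro h0
    have := congrFun hg (edgeAt π 1 s)
    rw [Pi.add_apply, h0] at this
    simp at this
  obtain ⟨L1, t, L2, h2, h3⟩ := exists_cross π _ L _ h1
  subst h2
  rw [one_mul] at h3
  have key : ∀ L' : List (α × Bool), L' <:+: s :: (L1 ++ t :: L2) → L' ≠ [] → π (mk L') = 1 →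
      L'.length ≤ L1.length + 1 → G + 1 ≤ (s :: (L1 ++ t :: L2)).length := by
    intro L' hi hne' hp hlen
    have hr : IsReduced L' := hred.infix hi
    have := hG _ hp (mk_ne_one_of_reduced hr hne')
    have h4 : (mk L' : FreeGroup α).norm ≤ L'.length := norm_mk_le
    simp only [List.length_cons, List.length_append]
    omega
  have key1 : π (mk (s :: L1)) = 1 → G + 1 ≤ (s :: (L1 ++ t :: L2)).length := fun hp =>
    key (s :: L1) ⟨[], t :: L2, by simp⟩ (by simp) hp (by simp)
  have key2 : L1 ≠ [] → π (mk L1) = 1 → G + 1 ≤ (s :: (L1 ++ t :: L2)).length := fun h0 hp =>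
    key L1 ⟨[s], t :: L2, by simp⟩ h0 hp (by simp)
  have key3 : s.1 = t.1 → s.2 ≠ t.2 → L1 ≠ [] := by
    rintro h4 h5 rfl
    have : IsReduced [s, t] := hred.infix ⟨[], L2, by simp⟩
    simp [isReduced_cons_cons] at this
    exact h5 (this h4)
  obtain ⟨i, b⟩ := s
  obtain ⟨j, b'⟩ := t
  have hf : (mk [(i, false)] : FreeGroup α) = (of i)⁻¹ := rfl
  have ht : (mk [(i, true)] : FreeGroup α) = of i := rfl
  simp only [edgeAt, Prod.mk.injEq] at h3
  obtain ⟨h3, rfl⟩ := h3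
  cases b <;> cases b'
  · apply key1
    rw [mk_cons', _root_.map_mul]
    simpa using h3
  · apply key2 (key3 rfl (by simp))
    simpa [hf] using h3
  · apply key2 (key3 rfl (by simp))
    simpa [ht] using h3
  · apply key1
    rw [mk_cons', _root_.map_mul]
    simpa using h3

end AGS

section AGS2

set_option linter.unusedSectionVars false
set_option linter.style.haveILetI false
set_option linter.unusedSimpArgs false

open FreeGroup

/-- The intersection of the kernels of all homomorphisms to `ℤ/2`. -/
def kerTwo (G : Type) [Group G] : Subgroup G := ⨅ φ : G →* Multiplicative (ZMod 2), φ.ker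

lemma mem_kerTwo {G : Type} [Group G] (g : G) :
    g ∈ kerTwo G ↔ ∀ φ : G →* Multiplicative (ZMod 2), φ g = 1 := by
  simp [kerTwo, Subgroup.mem_iInf, MonoidHom.mem_ker]

lemma kerTwo_char (G : Type) [Group G] : (kerTwo G).Characteristic := by
  rw [Subgroup.characteristic_iff_le_comap]
  intro ϕ g hg
  rw [Subgroup.mem_comap, mem_kerTwo]
  intro φ
  exact (mem_kerTwo g).1 hg (φ.comp ϕ.toMonoidHom)

/-- The next subgroup in the chain. -/
def nextSub {G : Type} [Group G] (N : Subgroup G) : Subgroup G := (kerTwo N).map N.subtype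

lemma mem_nextSub {G : Type} [Group G] (N : Subgroup G) (g : G) :
    g ∈ nextSub N ↔ ∃ h : g ∈ N, ∀ φ : N →* Multiplicative (ZMod 2), φ ⟨g, h⟩ = 1 := by
  simp only [nextSub, Subgroup.mem_map, mem_kerTwo]
  constructor
  · rintro ⟨x, hx, rfl⟩
    exact ⟨x.2, hx⟩
  · rintro ⟨h, hx⟩
    exact ⟨⟨g, h⟩, hx, rfl⟩

lemma nextSub_le {G : Type} [Group G] (N : Subgroup G) : nextSub N ≤ N := by
  intro g hg
  exact ((mem_nextSub N g).1 hg).1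

lemma nextSub_subgroupOf {G : Type} [Group G] (N : Subgroup G) :
    ((nextSub N).subgroupOf N).Characteristic := by
  have : (nextSub N).subgroupOf N = kerTwo N :=
    Subgroup.comap_map_eq_self_of_injective N.subtype_injective _
  rw [this]
  exact kerTwo_char N

lemma nextSub_char {G : Type} [Group G] (N : Subgroup G) (hN : N.Characteristic) :
    (nextSub N).Characteristic := by
  rw [Subgroup.characteristic_iff_le_comap] at hN ⊢
  intro ϕ g hg
  obtain ⟨h, hφ⟩ := (mem_nextSub N g).1 hg
  rw [Subgroup.mem_comap, mem_nextSub]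
  refine ⟨hN ϕ h, fun φ => ?_⟩
  let ψ : N →* N := (ϕ.toMonoidHom.comp N.subtype).codRestrict N (fun x => hN ϕ x.2)
  exact hφ (φ.comp ψ)

variable {α : Type} [Fintype α] [DecidableEq α]

/-- The Schreier cocycle of a homomorphism `φ : N → ℤ/2`. -/
noncomputable def schr (N : Subgroup (FreeGroup α)) [N.Normal]
    (φ : N →* Multiplicative (ZMod 2)) (a : FreeGroup α ⧸ N) (g : FreeGroup α) : ZMod 2 :=
  Multiplicative.toAdd (φ ⟨a.out * g * ((a * QuotientGroup.mk' N g).out)⁻¹, by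
    rw [← QuotientGroup.eq_one_iff]
    simp⟩)

lemma schr_mul (N : Subgroup (FreeGroup α)) [N.Normal]
    (φ : N →* Multiplicative (ZMod 2)) (a : FreeGroup α ⧸ N) (g h : FreeGroup α) :
    schr N φ a (g * h) = schr N φ a g + schr N φ (a * QuotientGroup.mk' N g) h := by
  unfold schr
  rw [← toAdd_mul, ← _root_.map_mul]
  congr 2
  ext
  simp [mul_assoc]

lemma schr_one (N : Subgroup (FreeGroup α)) [N.Normal]
    (φ : N →* Multiplicative (ZMod 2)) (a : FreeGroup α ⧸ N) :
    schr N φ a 1 = 0 := by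
  have := schr_mul N φ a 1 1
  simpa using this

lemma schr_letter (N : Subgroup (FreeGroup α)) [N.Normal]
    (φ : N →* Multiplicative (ZMod 2)) (a : FreeGroup α ⧸ N) (s : α × Bool) :
    schr N φ a (mk [s]) = (fun e : (FreeGroup α ⧸ N) × α => schr N φ e.1 (of e.2))
      (edgeAt (QuotientGroup.mk' N) a s) := by
  obtain ⟨i, b⟩ := s
  cases b
  · have h1 : (mk [(i, false)] : FreeGroup α) = (of i)⁻¹ := rfl
    have h := schr_mul N φ a (of i)⁻¹ (of i)
    rw [inv_mul_cancel, schr_one, eq_comm, CharTwo.add_eq_zero] at h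
    rw [h1, h]
    simp [edgeAt]
  · rfl

lemma schr_eq_sum (N : Subgroup (FreeGroup α)) [N.Normal] [Fintype (FreeGroup α ⧸ N)]
    (φ : N →* Multiplicative (ZMod 2)) (a : FreeGroup α ⧸ N) (L : List (α × Bool)) :
    schr N φ a (mk L) = ∑ e : (FreeGroup α ⧸ N) × α,
      chn (QuotientGroup.mk' N) a (mk L) e * schr N φ e.1 (of e.2) := by
  classical
  induction L generalizing a with
  | nil =>
    have : (mk [] : FreeGroup α) = 1 := rfl
    rw [this, chn_one, schr_one]
    simp
  | cons s L ih =>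
    rw [chn_cons, mk_cons' s L, schr_mul, ih, schr_letter]
    simp only [Pi.add_apply, add_mul, Finset.sum_add_distrib]
    congr 1
    rw [Finset.sum_eq_single (edgeAt (QuotientGroup.mk' N) a s)]
    · simp
    · intro e _ he
      simp [he]
    · simp

lemma mem_nextSub_iff (N : Subgroup (FreeGroup α)) [N.Normal] [N.FiniteIndex]
    (g : FreeGroup α) :
    g ∈ nextSub N ↔ g ∈ N ∧ chn (QuotientGroup.mk' N) 1 g = 0 := by
  classical
  rw [mem_nextSub]
  constructor
  · rintro ⟨h, hφ⟩
    refine ⟨h, ?_⟩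
    funext e
    let ψ : N →* Multiplicative (ZMod 2) :=
      { toFun := fun x => Multiplicative.ofAdd (chn (QuotientGroup.mk' N) 1 (x : FreeGroup α) e)
        map_one' := by simp [chn_one]
        map_mul' := by
          intro x y
          have : QuotientGroup.mk' N (x : FreeGroup α) = 1 :=
            (QuotientGroup.eq_one_iff _).2 x.2
          rw [Subgroup.coe_mul, chn_mul, this]
          simp }
    have := hφ ψ
    exact Multiplicative.ofAdd.injective this
  · rintro ⟨h, hc⟩
    refine ⟨h, fun φ => ?_⟩
    haveI : Fintype (FreeGroup α ⧸ N) := Fintype.ofFinite _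
    have h1 := schr_eq_sum N φ 1 g.toWord
    rw [mk_toWord, hc] at h1
    simp only [Pi.zero_apply, zero_mul, Finset.sum_const_zero] at h1
    have hg1 : QuotientGroup.mk' N g = 1 := (QuotientGroup.eq_one_iff _).2 h
    have ho : (1 : FreeGroup α ⧸ N).out ∈ N := by
      rw [← QuotientGroup.eq_one_iff]; simp
    have h2 : φ (⟨_, ho⟩ * ⟨g, h⟩ * ⟨_, ho⟩⁻¹) = 1 := by
      refine Multiplicative.toAdd.injective ?_
      rw [toAdd_one, ← h1]
      unfold schr
      congr 2
      ext
      simp [hg1]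
    rw [_root_.map_mul, _root_.map_mul, _root_.map_inv, mul_comm, inv_mul_cancel_left] at h2
    exact h2

lemma nextSub_finiteIndex (N : Subgroup (FreeGroup α)) [N.Normal] [N.FiniteIndex] :
    (nextSub N).FiniteIndex := by
  haveI : Finite (Multiplicative (α → ZMod 2)) := inferInstanceAs (Finite (α → ZMod 2))
  haveI : (magnus (QuotientGroup.mk' N)).ker.FiniteIndex := inferInstance
  refine Subgroup.finiteIndex_of_le (H := (magnus (QuotientGroup.mk' N)).ker) ?_
  intro g hg
  rw [MonoidHom.mem_ker] at hg
  rw [mem_nextSub_iff]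
  constructor
  · rw [← QuotientGroup.eq_one_iff]
    have := magnus_right (QuotientGroup.mk' N) g
    rw [hg] at this
    exact this.symm
  · funext e
    simp [chn, hg]

/-- The chain of subgroups. -/
def chainSub (G : Type) [Group G] : ℕ → Subgroup G
  | 0 => ⊤
  | k + 1 => nextSub (chainSub G k)

lemma chainSub_char (G : Type) [Group G] (k : ℕ) : (chainSub G k).Characteristic := by
  induction k with
  | zero => exact Subgroup.topCharacteristic
  | succ k ih => exact nextSub_char _ ih

lemma chainSub_finiteIndex (k : ℕ) : (chainSub (FreeGroup α) k).FiniteIndex := by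
  induction k with
  | zero => exact inferInstanceAs (⊤ : Subgroup (FreeGroup α)).FiniteIndex
  | succ k ih =>
    haveI := chainSub_char (FreeGroup α) k
    exact nextSub_finiteIndex _

lemma chainSub_girth (k : ℕ) (g : FreeGroup α) (hg : g ∈ chainSub (FreeGroup α) k)
    (hne : g ≠ 1) : k + 1 ≤ g.norm := by
  induction k generalizing g with
  | zero =>
    have : g.norm ≠ 0 := fun h => hne (norm_eq_zero.1 h)
    omega
  | succ k ih =>
    haveI := chainSub_char (FreeGroup α) k
    haveI := chainSub_finiteIndex (α := α) k
    have h1 := (mem_nextSub_iff _ g).1 hg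
    exact girth_step (QuotientGroup.mk' (chainSub (FreeGroup α) k)) (k + 1)
      (fun h hh hne' => ih h ((QuotientGroup.eq_one_iff _).1 hh) hne') g h1.2 hne

lemma wordLength_eq (m : ℕ) (g : FreeGroup (Fin m)) :
    wordLength (freeBasisSet m) g = g.norm := by
  have hlow : ∀ l : List (FreeGroup (Fin m)), (∀ x ∈ l, x ∈ freeBasisSet m) →
      l.prod.norm ≤ l.length := by
    intro l hl
    induction l with
    | nil => simp
    | cons x l ih =>
      have h1 := ih (fun y hy => hl y (by simp [hy]))
      have h2 : x.norm = 1 := by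
        obtain ⟨i, rfl | rfl⟩ := hl x (by simp)
        · simp
        · rw [norm_inv_eq]; simp
      have h3 := norm_mul_le x l.prod
      simp only [List.prod_cons, List.length_cons]
      omega
  have hmk : ∀ L : List (Fin m × Bool), (L.map (fun s => mk [s])).prod = mk L := by
    intro L
    induction L with
    | nil => rfl
    | cons s L ih => rw [List.map_cons, List.prod_cons, ih, mk_cons' s L]
  have hex : (g.norm : ℝ) ∈ {r : ℝ | ∃ n : ℕ, r = n ∧ ∃ w : Fin n → FreeGroup (Fin m),
      (∀ i, w i ∈ freeBasisSet m) ∧ (List.ofFn w).prod = g} := by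
    refine ⟨(g.toWord.map (fun s => (mk [s] : FreeGroup (Fin m)))).length,
      by rw [List.length_map]; rfl,
      (g.toWord.map (fun s => (mk [s] : FreeGroup (Fin m)))).get, ?_, ?_⟩
    · intro j
      have hj := List.get_mem (g.toWord.map (fun s => (mk [s] : FreeGroup (Fin m)))) j
      rw [List.mem_map] at hj
      obtain ⟨⟨i, b⟩, -, hb⟩ := hj
      rw [← hb]
      refine ⟨i, ?_⟩
      cases b
      · exact Or.inr rfl
      · exact Or.inl rfl
    · rw [List.ofFn_get, hmk, mk_toWord]
  apply le_antisymm
  · refine csInf_le ⟨0, ?_⟩ hex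
    rintro r ⟨n, rfl, -⟩
    positivity
  · refine le_csInf ⟨_, hex⟩ ?_
    · rintro r ⟨n, rfl, w, hw, hp⟩
      have := hlow (List.ofFn w) (by
        intro x hx
        rw [List.mem_ofFn] at hx
        obtain ⟨j, rfl⟩ := hx
        exact hw j)
      rw [hp, List.length_ofFn] at this
      exact_mod_cast this

lemma chn_congr (N : Subgroup (FreeGroup α)) [N.Normal] [N.FiniteIndex]
    (g h : FreeGroup α) (hgh : (g : FreeGroup α ⧸ nextSub N) = h) :
    chn (QuotientGroup.mk' N) 1 g = chn (QuotientGroup.mk' N) 1 h := by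
  have h1 := (mem_nextSub_iff N _).1 (QuotientGroup.eq.1 hgh)
  have h2 := chn_mul (QuotientGroup.mk' N) 1 g (g⁻¹ * h)
  rw [mul_inv_cancel_left] at h2
  rw [h2]
  funext e
  rw [Pi.add_apply, chn_base _ (1 * _), h1.2]
  simp

lemma wt_sub (N : Subgroup (FreeGroup α)) [N.Normal] (g h : FreeGroup α) :
    wt (chn (QuotientGroup.mk' N) 1 g + chn (QuotientGroup.mk' N) 1 h) =
      wt (chn (QuotientGroup.mk' N) 1 (g⁻¹ * h)) := by
  have h2 := chn_mul (QuotientGroup.mk' N) 1 g (g⁻¹ * h)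
  rw [mul_inv_cancel_left] at h2
  rw [h2, ← add_assoc, fun2_add_self, zero_add, wt_chn_base]

lemma embed_one (m k : ℕ) : ∃ (ι : Type) (_ : Fintype ι)
    (Ψ : FreeGroup (Fin m) ⧸ chainSub (FreeGroup (Fin m)) (k + 1) → EuclideanSpace ℝ ι),
    ∀ x y, ∃ w : ℕ, dist (Ψ x) (Ψ y) = Real.sqrt w ∧
      (w : ℝ) ≤ quotDist (wordLength (freeBasisSet m)) (chainSub (FreeGroup (Fin m)) (k + 1)) x y ∧
      (w < k + 1 →
        quotDist (wordLength (freeBasisSet m)) (chainSub (FreeGroup (Fin m)) (k + 1)) x y ≤ w) := by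
  classical
  set N := chainSub (FreeGroup (Fin m)) k with hN
  haveI := chainSub_char (FreeGroup (Fin m)) k
  haveI : N.Normal := by rw [hN]; infer_instance
  haveI : N.FiniteIndex := chainSub_finiteIndex (α := Fin m) k
  haveI : Fintype (FreeGroup (Fin m) ⧸ N) := Fintype.ofFinite _
  have hN' : chainSub (FreeGroup (Fin m)) (k + 1) = nextSub N := rfl
  rw [hN']
  refine ⟨(FreeGroup (Fin m) ⧸ N) × Fin m, inferInstance, fun x =>
    WithLp.toLp 2 (fun e => ((chn (QuotientGroup.mk' N) 1 x.out e).val : ℝ)), fun x y => ?_⟩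
  refine ⟨wt (chn (QuotientGroup.mk' N) 1 (x.out⁻¹ * y.out)), ?_, ?_, ?_⟩
  · rw [EuclideanSpace.dist_eq, ← wt_sub]
    congr 1
    have hpt : ∀ a b : ZMod 2, dist (a.val : ℝ) (b.val : ℝ) ^ 2 = if a + b ≠ 0 then 1 else 0 := by
      intro a b
      rw [Real.dist_eq]
      have h01 : ∀ c : ZMod 2, c = 0 ∨ c = 1 := by decide
      have h11 : (1 : ZMod 2) + 1 = 0 := by decide
      have hv : (1 : ZMod 2).val = 1 := by decide
      rcases h01 a with rfl | rfl <;> rcases h01 b with rfl | rfl <;> simp [hv, h11]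
    simp only [hpt]
    rw [wt, Set.ncard_eq_toFinset_card', Finset.sum_ite, Finset.sum_const_zero, add_zero,
      Finset.sum_const, nsmul_eq_mul, mul_one]
    congr 2
    ext e
    simp
  · refine le_csInf ⟨_, x.out, y.out, by simp, by simp, rfl⟩ ?_
    rintro r ⟨g, h, hg, hh, rfl⟩
    rw [wordLength_eq, ← wt_sub,
      chn_congr N x.out g (by rw [hg]; simp), chn_congr N y.out h (by rw [hh]; simp), wt_sub]
    have hle := wt_chn_le (QuotientGroup.mk' N) 1 (g⁻¹ * h)
    exact_mod_cast hle
  · intro hw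
    obtain ⟨z, z1, z2, z3⟩ := short_rep (QuotientGroup.mk' N) (k + 1)
      (fun h hh hne => chainSub_girth k h ((QuotientGroup.eq_one_iff _).1 hh) hne) _ hw
    refine (csInf_le (a := (z.norm : ℝ)) ⟨0, ?_⟩ ?_).trans (by exact_mod_cast z3)
    · rintro r ⟨g, h, -, -, rfl⟩
      rw [wordLength_eq]
      positivity
    · refine ⟨x.out, x.out * z, by simp, ?_, ?_⟩
      · rw [← QuotientGroup.out_eq' y, QuotientGroup.eq]
        rw [mem_nextSub_iff]
        have e1 : (x.out * z)⁻¹ * y.out = z⁻¹ * (x.out⁻¹ * y.out) := by group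
        rw [e1]
        refine ⟨QuotientGroup.eq.1 z1, ?_⟩
        apply wt_eq_zero
        rw [← wt_sub, z2, fun2_add_self]
        simp [wt]
      · rw [wordLength_eq, inv_mul_cancel_left]

end AGS2

/-- For every rank `m ≥ 1` there is a chain of finite-index
characteristic subgroups `N_{m,k}` of the free group `F_m` with trivial intersection,
each characteristic in the previous one, such that the family of quotients
`F_m / N_{m,k}` over `k ≥ m ≥ 1`, with the quotient word metrics, coarsely embeds
uniformly into Hilbert space. -/
theorem statement17 :
    ∃ N : (m : ℕ) → ℕ → Subgroup (FreeGroup (Fin m)),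
      (∀ m, 1 ≤ m → ∀ k, (N m k).FiniteIndex ∧ (N m k).Characteristic) ∧
      (∀ m, 1 ≤ m → ∀ k, N m (k + 1) ≤ N m k ∧
        ((N m (k + 1)).subgroupOf (N m k)).Characteristic) ∧
      (∀ m, 1 ≤ m → (⨅ k, N m k) = ⊥) ∧
      UnifCoarseEmbedHilbert
        (fun p : {q : ℕ × ℕ // 1 ≤ q.1 ∧ q.1 ≤ q.2} =>
          FreeGroup (Fin p.1.1) ⧸ N p.1.1 p.1.2)
        (fun p => quotDist (wordLength (freeBasisSet p.1.1)) (N p.1.1 p.1.2)) := by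
  classical
  refine ⟨fun m k => chainSub (FreeGroup (Fin m)) k, fun m _ k =>
    ⟨chainSub_finiteIndex k, chainSub_char _ k⟩, fun m _ k =>
    ⟨nextSub_le _, nextSub_subgroupOf _⟩, fun m _ => ?_, ?_⟩
  · rw [eq_bot_iff]
    intro g hg
    rw [Subgroup.mem_iInf] at hg
    rw [Subgroup.mem_bot]
    by_contra hne
    have := chainSub_girth g.norm g (hg _) hne
    omega
  · have hB : ∀ m k : ℕ, ∃ B : ℝ, ∀ x y,
        quotDist (wordLength (freeBasisSet m)) (chainSub (FreeGroup (Fin m)) k) x y ≤ B := by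
      intro m k
      haveI := chainSub_finiteIndex (α := Fin m) k
      obtain ⟨B, hB⟩ := (Set.finite_range (fun z : (FreeGroup (Fin m) ⧸
        chainSub (FreeGroup (Fin m)) k) × (FreeGroup (Fin m) ⧸ chainSub (FreeGroup (Fin m)) k) =>
        quotDist (wordLength (freeBasisSet m)) (chainSub (FreeGroup (Fin m)) k) z.1 z.2)).bddAbove
      exact ⟨B, fun x y => hB ⟨(x, y), rfl⟩⟩
    choose B hB using hB
    let M : ℕ → ℝ := fun K => ∑ k ∈ Finset.range (K + 1), ∑ m ∈ Finset.range (k + 1), |B m k|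
    have hM : ∀ m k K, m ≤ k → k ≤ K → ∀ x y,
        quotDist (wordLength (freeBasisSet m)) (chainSub (FreeGroup (Fin m)) k) x y ≤ M K := by
      intro m k K hmk hkK x y
      refine (hB m k x y).trans ((le_abs_self _).trans ?_)
      have h1 : |B m k| ≤ ∑ m ∈ Finset.range (k + 1), |B m k| :=
        Finset.single_le_sum (f := fun m => |B m k|) (fun i _ => abs_nonneg _)
          (Finset.mem_range.2 (by omega))
      refine h1.trans ?_
      exact Finset.single_le_sum (f := fun k => ∑ m ∈ Finset.range (k + 1), |B m k|)
        (fun i _ => Finset.sum_nonneg fun j _ => abs_nonneg _) (Finset.mem_range.2 (by omega))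
    have hE : ∀ p : {q : ℕ × ℕ // 1 ≤ q.1 ∧ q.1 ≤ q.2}, ∃ (ι : Type) (_ : Fintype ι)
        (Ψ : FreeGroup (Fin p.1.1) ⧸ chainSub (FreeGroup (Fin p.1.1)) p.1.2 →
          EuclideanSpace ℝ ι), ∀ x y, ∃ w : ℕ, dist (Ψ x) (Ψ y) = Real.sqrt w ∧
        (w : ℝ) ≤ quotDist (wordLength (freeBasisSet p.1.1))
          (chainSub (FreeGroup (Fin p.1.1)) p.1.2) x y ∧
        (w < p.1.2 → quotDist (wordLength (freeBasisSet p.1.1))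
          (chainSub (FreeGroup (Fin p.1.1)) p.1.2) x y ≤ w) := by
      rintro ⟨⟨m, k⟩, h1, h2⟩
      obtain ⟨k, rfl⟩ : ∃ k', k = k' + 1 := ⟨k - 1, by simp only at h1 h2; omega⟩
      exact embed_one m k
    choose ι hι Ψ hΨ using hE
    let κ : ℝ → ℕ := fun t => Nat.findGreatest (fun K => M K < t) ⌊t⌋₊
    have hκ : Monotone κ := fun s t hst =>
      Nat.findGreatest_mono (fun K (h : M K < s) => lt_of_lt_of_le h hst) (Nat.floor_mono hst)
    refine ⟨fun p => EuclideanSpace ℝ (ι p), fun p => inferInstance, fun p => inferInstance,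
      fun p => inferInstance, Ψ, fun t => Real.sqrt (κ t), Real.sqrt, ?_,
      fun s t hst => Real.sqrt_le_sqrt hst, ?_, ?_⟩
    · intro s t hst
      exact Real.sqrt_le_sqrt (by exact_mod_cast hκ hst)
    · refine Real.tendsto_sqrt_atTop.comp (tendsto_natCast_atTop_atTop.comp ?_)
      rw [Filter.tendsto_atTop]
      intro b
      filter_upwards [Filter.eventually_ge_atTop (b : ℝ), Filter.eventually_gt_atTop (M b)]
        with t h1 h2
      exact Nat.le_findGreatest (Nat.le_floor h1) h2
    · intro p x y
      obtain ⟨w, h1, h2, h3⟩ := hΨ p x y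
      rw [h1]
      refine ⟨Real.sqrt_le_sqrt ?_, Real.sqrt_le_sqrt h2⟩
      have hle : κ (quotDist (wordLength (freeBasisSet p.1.1))
          (chainSub (FreeGroup (Fin p.1.1)) p.1.2) x y) ≤ w := by
        by_cases hw : w < p.1.2
        · exact (Nat.findGreatest_le _).trans (Nat.floor_le_of_le (h3 hw))
        · by_contra hcon
          push Not at hcon hw
          have hlt := Nat.findGreatest_of_ne_zero (P := fun K => M K < quotDist
            (wordLength (freeBasisSet p.1.1)) (chainSub (FreeGroup (Fin p.1.1)) p.1.2) x y)
            (m := κ (quotDist (wordLength (freeBasisSet p.1.1))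
              (chainSub (FreeGroup (Fin p.1.1)) p.1.2) x y)) rfl (by omega)
          exact absurd (hM p.1.1 p.1.2 _ p.2.2 (hw.trans hcon.le) x y) (not_le.2 hlt)
      exact_mod_cast hle
end

section
/- Let A and B be finitely generated groups with finite symmetric generating sets S_A and S_B, and let (K_n)_{n∈ℕ} and (L_n)_{n∈ℕ} be sequences of finite-index normal subgroups of A and of B respectively such that the quotient sequences (A/K_n) and (B/L_n) are faithful, i.e. every nontrivial element of A (resp. B) has nontrivial image in A/K_n (resp. B/L_n) for all but finitely many n. Equip each A/K_n and B/L_n with the quotient length induced by the word length of S_A and S_B respectively, and equip each free product G_n = (A/K_n) ∗ (B/L_n) with the word length of the generating set consisting of the canonical images of S_A and S_B. If the sequences (A/K_n)_{n∈ℕ} and (B/L_n)_{n∈ℕ} coarsely embed uniformly into Hilbert space, then the sequence (G_n)_{n∈ℕ} coarsely embeds uniformly into Hilbert space. -/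
namespace S18

section WL
variable {G : Type*} [Group G] {S : Set G}

theorem wl_le_length (l : List G) (hl : ∀ x ∈ l, x ∈ S) : wordLength S l.prod ≤ l.length := by
  unfold wordLength
  apply csInf_le
  · refine ⟨0, ?_⟩
    rintro r ⟨m, rfl, _⟩
    positivity
  · refine ⟨l.length, rfl, l.get, fun i => hl _ (List.get_mem _ _), ?_⟩
    simp

theorem wl_exists (hS : Submonoid.closure S = ⊤) (g : G) :
    ∃ l : List G, (∀ x ∈ l, x ∈ S) ∧ l.prod = g ∧ wordLength S g = l.length := by
  classical
  have hex : ∃ m : ℕ, ∃ l : List G, (∀ x ∈ l, x ∈ S) ∧ l.prod = g ∧ l.length = m := by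
    obtain ⟨l, h1, h2⟩ := Submonoid.exists_list_of_mem_closure (s := S) (x := g) (by simp [hS])
    exact ⟨l.length, l, h1, h2, rfl⟩
  obtain ⟨l, h1, h2, h3⟩ := Nat.find_spec hex
  refine ⟨l, h1, h2, le_antisymm (h2 ▸ wl_le_length l h1) ?_⟩
  unfold wordLength
  apply le_csInf
  · exact ⟨l.length, l.length, rfl, l.get, fun i => h1 _ (List.get_mem _ _), by simpa using h2⟩
  · rintro r ⟨m, rfl, w, hw, hp⟩
    rw [h3]
    have := Nat.find_min' hex (m := m) ⟨List.ofFn w, by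
      intro x hx
      rw [List.mem_ofFn] at hx
      obtain ⟨i, rfl⟩ := hx
      exact hw i, hp, by simp⟩
    exact_mod_cast this

theorem wl_nonneg (g : G) : 0 ≤ wordLength S g := by
  apply Real.sInf_nonneg
  rintro r ⟨m, rfl, _⟩
  positivity

theorem wl_one : wordLength S (1 : G) = 0 :=
  le_antisymm (by simpa using wl_le_length (S := S) ([] : List G) (by simp)) (wl_nonneg _)

theorem wl_mul (hS : Submonoid.closure S = ⊤) (g h : G) :
    wordLength S (g * h) ≤ wordLength S g + wordLength S h := by
  obtain ⟨l, h1, rfl, h3⟩ := wl_exists hS g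
  obtain ⟨l', h1', rfl, h3'⟩ := wl_exists hS h
  rw [h3, h3', ← List.prod_append]
  refine (wl_le_length (S := S) (l ++ l') ?_).trans (by simp)
  intro x hx
  rcases List.mem_append.1 hx with h | h
  · exact h1 _ h
  · exact h1' _ h

theorem wl_map {A : Type*} [Group A] {T : Set A} (hT : Submonoid.closure T = ⊤) (f : A →* G)
    (hf : ∀ a ∈ T, f a ∈ S) (a : A) : wordLength S (f a) ≤ wordLength T a := by
  obtain ⟨l, h1, rfl, h3⟩ := wl_exists hT a
  rw [h3, map_list_prod]
  refine (wl_le_length (S := S) (l.map f) ?_).trans (by simp)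
  intro x hx
  obtain ⟨y, hy, rfl⟩ := List.mem_map.1 hx
  exact hf _ (h1 _ hy)

theorem mclosure_of_sym (hsym : ∀ s ∈ S, s⁻¹ ∈ S) (hgen : Subgroup.closure S = ⊤) :
    Submonoid.closure S = ⊤ := by
  have h := Subgroup.closure_toSubmonoid S
  have h2 : S ∪ S⁻¹ = S := by
    apply Set.union_eq_left.2
    intro x hx
    simpa using hsym _ hx
  rw [h2, hgen] at h
  rw [← h]
  rfl

end WL

open Monoid

section Coord
variable {ι : Type} {M : ι → Type} [∀ i, Group (M i)]

/-- Vertices of the tree. -/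
abbrev Vert (M : ι → Type) : Type := List (Σ i, M i) × ι

open Classical in
/-- Coordinates of a word at the vertices. -/
noncomputable def X : List (Σ i, M i) → (v : Vert M) → M v.2
  | [] => fun _ => 1
  | (p :: t) => Function.update (X t) (t, p.1) p.2

theorem X_cons_self (i : ι) (c : M i) (t : List (Σ i, M i)) : X (⟨i, c⟩ :: t) (t, i) = c := by
  classical
  simp only [X]
  exact Function.update_self (β := fun v : Vert M => M v.2) (t, i) c _

theorem X_cons_ne (p : Σ i, M i) (t : List (Σ i, M i)) (v : Vert M) (hv : v ≠ (t, p.1)) :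
    X (p :: t) v = X t v := by
  classical
  simp only [X]
  exact Function.update_of_ne hv _ _

theorem X_long (w : List (Σ i, M i)) (v : Vert M) (h : w.length ≤ v.1.length) : X w v = 1 := by
  induction w with
  | nil => rfl
  | cons p t ih =>
    rw [X_cons_ne]
    · apply ih
      simp at h
      omega
    · rintro rfl
      simp at h

theorem X_fin (w : List (Σ i, M i)) : {v | X w v ≠ 1}.Finite := by
  induction w with
  | nil => simp [X]
  | cons p t ih =>
    refine (ih.insert (t, p.1)).subset ?_
    intro v hv
    by_cases h : v = (t, p.1)
    · exact Or.inl h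
    · right
      simpa [X_cons_ne _ _ _ h] using hv

/-- product of a list. -/
def lprod (l : List (Σ i, M i)) : CoprodI M := (l.map fun p => CoprodI.of p.2).prod

theorem dist_le {G : Type*} [Group G] (θ : CoprodI M →* G) (L : G → ℝ) (h1 : L 1 = 0)
    (hmul : ∀ g h, L (g * h) ≤ L g + L h) (n : ℕ) : ∀ u w : List (Σ i, M i),
    u.length + w.length ≤ n → ∃ T : Finset (Vert M),
      L (θ (lprod u) * (θ (lprod w))⁻¹) ≤
        ∑ v ∈ T, L (θ (CoprodI.of (X u v * (X w v)⁻¹))) := by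
  classical
  induction n with
  | zero =>
    intro u w h
    have hu : u = [] := List.length_eq_zero_iff.1 (by omega)
    have hw : w = [] := List.length_eq_zero_iff.1 (by omega)
    subst hu hw
    exact ⟨∅, by simp [h1]⟩
  | succ n ih =>
    intro u w h
    have stepL : ∀ (i : ι) (c : M i) (t : List (Σ i, M i)), u = ⟨i, c⟩ :: t →
        X w (t, i) = 1 → ∃ T : Finset (Vert M), L (θ (lprod u) * (θ (lprod w))⁻¹) ≤
        ∑ v ∈ T, L (θ (CoprodI.of (X u v * (X w v)⁻¹))) := by
      rintro i c t rfl hX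
      obtain ⟨T, hT⟩ := ih t w (by simp at h; omega)
      have hT' : L (θ (lprod t) * (θ (lprod w))⁻¹) ≤
          ∑ v ∈ T.erase (t, i), L (θ (CoprodI.of (X t v * (X w v)⁻¹))) := by
        rwa [Finset.sum_erase]
        rw [hX, X_long t (t, i) le_rfl]
        simp [h1]
      refine ⟨insert (t, i) (T.erase (t, i)), ?_⟩
      rw [Finset.sum_insert (by simp), X_cons_self, hX]
      rw [Finset.sum_congr rfl (g := fun v => L (θ (CoprodI.of (X t v * (X w v)⁻¹))))]
      · refine le_trans ?_ (add_le_add_right hT' _)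
        refine le_trans (le_of_eq ?_) (hmul _ _)
        simp [lprod, mul_assoc]
      · intro v hv
        rw [X_cons_ne]
        exact (Finset.mem_erase.1 hv).1
    have stepR : ∀ (i : ι) (c : M i) (t : List (Σ i, M i)), w = ⟨i, c⟩ :: t →
        X u (t, i) = 1 → ∃ T : Finset (Vert M), L (θ (lprod u) * (θ (lprod w))⁻¹) ≤
        ∑ v ∈ T, L (θ (CoprodI.of (X u v * (X w v)⁻¹))) := by
      rintro i c t rfl hX
      obtain ⟨T, hT⟩ := ih u t (by simp at h; omega)
      have hT' : L (θ (lprod u) * (θ (lprod t))⁻¹) ≤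
          ∑ v ∈ T.erase (t, i), L (θ (CoprodI.of (X u v * (X t v)⁻¹))) := by
        rwa [Finset.sum_erase]
        rw [hX, X_long t (t, i) le_rfl]
        simp [h1]
      refine ⟨insert (t, i) (T.erase (t, i)), ?_⟩
      rw [Finset.sum_insert (by simp), X_cons_self, hX]
      rw [Finset.sum_congr rfl (g := fun v => L (θ (CoprodI.of (X u v * (X t v)⁻¹))))]
      · refine le_trans ?_ (add_le_add_right hT' _)
        rw [add_comm]
        refine le_trans (le_of_eq ?_) (hmul _ _)
        simp [lprod, mul_assoc]
      · intro v hv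
        rw [X_cons_ne]
        exact (Finset.mem_erase.1 hv).1
    rcases lt_trichotomy u.length w.length with hlt | heq | hgt
    · cases w with
      | nil => simp at hlt
      | cons p t =>
        obtain ⟨i, c⟩ := p
        refine stepR i c t rfl (X_long _ _ ?_)
        simp at hlt ⊢
        omega
    · cases u with
      | nil =>
        have hw : w = [] := List.length_eq_zero_iff.1 (by simpa using heq.symm)
        subst hw
        exact ⟨∅, by simp [h1]⟩
      | cons p t =>
        obtain ⟨i, c⟩ := p
        cases w with
        | nil => simp at heq
        | cons q t' =>
          by_cases hv : (t, i) = (t', q.1)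
          · obtain ⟨j, c'⟩ := q
            simp only [Prod.mk.injEq] at hv
            obtain ⟨rfl, rfl⟩ := hv
            refine ⟨{(t, i)}, ?_⟩
            simp only [Finset.sum_singleton, X_cons_self]
            apply le_of_eq
            simp [lprod]
          · refine stepL i c t rfl ?_
            rw [X_cons_ne _ _ _ hv]
            apply X_long
            simp at heq ⊢
            omega
    · cases u with
      | nil => simp at hgt
      | cons p t =>
        obtain ⟨i, c⟩ := p
        refine stepL i c t rfl (X_long _ _ ?_)
        simp at hgt ⊢
        omega

open Classical in
theorem X_rcons {i : ι} (p : CoprodI.Word.Pair M i) (v : Vert M) :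
    X (CoprodI.Word.rcons p).toList v =
      Function.update (X p.tail.toList) (p.tail.toList, i) p.head v := by
  unfold CoprodI.Word.rcons
  split_ifs with h
  · by_cases hv : v = (p.tail.toList, i)
    · subst hv
      rw [X_long p.tail.toList (p.tail.toList, i) le_rfl]
      rw [Function.update_self, h]
    · rw [Function.update_of_ne hv]
  · rfl

end Coord

/-- data attached to one free factor -/
structure Piece (G : Type*) [Group G] (S : Set G) (ρ : ℝ → ℝ) where
  M : Type
  [grp : Group M]
  E : Type
  [nE : NormedAddCommGroup E]
  [iE : InnerProductSpace ℝ E]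
  [cE : CompleteSpace E]
  θ : M →* G
  F : M → E
  sep : ∀ x y, x ≠ y → 1 ≤ ‖F x - F y‖
  low : ∀ x y, ρ (wordLength S (θ (x * y⁻¹))) ≤ ‖F x - F y‖

attribute [instance] Piece.grp Piece.nE Piece.iE Piece.cE

/-- new lower control function -/
noncomputable def newRho (ρ : ℝ → ℝ) (t : ℝ) : ℝ := min (√√t) (ρ (√t))

theorem core {G : Type*} [Group G] (S : Set G) (hS : Submonoid.closure S = ⊤)
    (ρ : ℝ → ℝ) (hρ : Monotone ρ) (C : ℝ) {ι : Type} (P : ι → Piece G S ρ)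
    (η : G →* CoprodI (fun i => (P i).M))
    (hη : ∀ g, CoprodI.lift (fun i => (P i).θ) (η g) = g)
    (hgen : ∀ s ∈ S, ∃ (i : ι) (m : (P i).M), η s = CoprodI.of (M := fun i => (P i).M) m ∧
      ∀ x, ‖(P i).F (m * x) - (P i).F x‖ ≤ C) :
    ∃ (H : Type) (_ : NormedAddCommGroup H) (_ : InnerProductSpace ℝ H) (_ : CompleteSpace H)
      (Φ : G → H), ∀ g h : G, newRho ρ (wordLength S (g⁻¹ * h)) ≤ dist (Φ g) (Φ h) ∧
        dist (Φ g) (Φ h) ≤ C * wordLength S (g⁻¹ * h) := by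
  classical
  let M : ι → Type := fun i => (P i).M
  let E : Vert M → Type := fun v => (P v.2).E
  let θ : CoprodI M →* G := CoprodI.lift (fun i => (P i).θ)
  have hmem : ∀ w : List (Σ i, M i),
      Memℓp (E := E) (fun v => (P v.2).F (X w v) - (P v.2).F 1) 2 := by
    intro w
    refine (memℓp_zero ?_).of_exponent_ge zero_le
    refine (X_fin w).subset ?_
    intro v hv hv'
    apply hv
    simp [hv']
  let Ψ : List (Σ i, M i) → lp E 2 := fun w => ⟨_, hmem w⟩
  have hΨ : ∀ u w v, (Ψ u - Ψ w) v = (P v.2).F (X u v) - (P v.2).F (X w v) := by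
    intro u w v
    exact sub_sub_sub_cancel_right _ _ _
  let W : G → CoprodI.Word M := fun g => CoprodI.Word.equiv (η g)
  have hWprod : ∀ g, θ (lprod (W g).toList) = g := by
    intro g
    have : lprod (W g).toList = η g := CoprodI.Word.equiv.symm_apply_apply (η g)
    rw [this]
    exact hη g
  have hup1 : ∀ s ∈ S, ∀ g, ‖Ψ (W (s * g)).toList - Ψ (W g).toList‖ ≤ C := by
    intro s hs g
    obtain ⟨i, m, hm, hC⟩ := hgen s hs
    let p := CoprodI.Word.equivPair (M := M) i (W g)
    have e1 : W g = CoprodI.Word.rcons p := ((CoprodI.Word.equivPair i).symm_apply_apply _).symm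
    have e2 : W (s * g) = CoprodI.Word.rcons (M := M) (i := i)
        (CoprodI.Word.Pair.mk (M := M) (m * p.head) p.tail p.fstIdx_ne) := by
      simp only [W, map_mul, hm]
      change (((CoprodI.of (M := M) (i := i) m : CoprodI M) * (η g : CoprodI M)) • CoprodI.Word.empty : CoprodI.Word M) = _
      rw [mul_smul]
      rfl
    have : Ψ (W (s * g)).toList - Ψ (W g).toList =
        lp.single 2 ((p.tail.toList, i) : Vert M)
          ((P i).F (m * p.head) - (P i).F p.head : (P i).E) := by
      apply lp.ext
      funext v
      rw [hΨ, e2, e1, X_rcons, X_rcons]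
      by_cases hv : v = (p.tail.toList, i)
      · subst hv
        rw [lp.single_apply_self, Function.update_self, Function.update_self]
      · rw [lp.single_apply_ne _ _ _ hv, Function.update_of_ne hv, Function.update_of_ne hv,
          sub_self]
    rw [this, lp.norm_single (by norm_num)]
    exact hC _
  have hup2 : ∀ l : List G, (∀ x ∈ l, x ∈ S) → ∀ g,
      ‖Ψ (W (l.prod * g)).toList - Ψ (W g).toList‖ ≤ C * l.length := by
    intro l
    induction l with
    | nil => intro _ g; simp
    | cons s l ih =>
      intro hl g
      have a1 := ih (fun x hx => hl x (List.mem_cons_of_mem _ hx)) g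
      have a2 := hup1 s (hl s List.mem_cons_self) (l.prod * g)
      rw [List.prod_cons, mul_assoc]
      refine (norm_sub_le_norm_sub_add_norm_sub _ (Ψ (W (l.prod * g)).toList) _).trans ?_
      push_cast [List.length_cons]
      linarith
  refine ⟨lp E 2, inferInstance, inferInstance, inferInstance, fun g => Ψ (W g⁻¹).toList, ?_⟩
  intro g h
  rw [dist_eq_norm]
  constructor
  · obtain ⟨T, hT⟩ := dist_le θ (wordLength S) wl_one (wl_mul hS) _
      (W g⁻¹).toList (W h⁻¹).toList le_rfl
    rw [hWprod, hWprod, inv_inv] at hT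
    set u := (W g⁻¹).toList
    set w := (W h⁻¹).toList
    set D := wordLength S (g⁻¹ * h)
    set N := ‖Ψ u - Ψ w‖
    have hD0 : 0 ≤ D := wl_nonneg _
    set T' := T.filter (fun v => X u v ≠ X w v) with hT'
    have hT2 : D ≤ ∑ v ∈ T', wordLength S (θ (CoprodI.of (X u v * (X w v)⁻¹))) := by
      refine hT.trans (le_of_eq ?_)
      rw [hT', Finset.sum_filter_of_ne]
      intro v _ hne heq
      apply hne
      simp [heq, wl_one]
    have hv1 : ∀ v, ‖(P v.2).F (X u v) - (P v.2).F (X w v)‖ ≤ N := by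
      intro v
      rw [← hΨ]
      exact lp.norm_apply_le_norm (by norm_num) _ v
    have hcard : (T'.card : ℝ) ≤ N ^ 2 := by
      have := lp.sum_rpow_le_norm_rpow (p := 2) (by norm_num) (Ψ u - Ψ w) T'
      norm_num at this
      refine le_trans ?_ this
      rw [Finset.card_eq_sum_ones]
      push_cast
      apply Finset.sum_le_sum
      intro v hv
      have h1 := (P v.2).sep _ _ (Finset.mem_filter.1 hv).2
      have h2 := hΨ u w v
      simp only [lp.coeFn_sub, Pi.sub_apply] at h2
      rw [h2]
      nlinarith
    by_cases hall : ∀ v ∈ T', wordLength S (θ (CoprodI.of (X u v * (X w v)⁻¹))) ≤ √D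
    · refine (min_le_left _ _).trans ?_
      apply Real.sqrt_le_iff.2 ⟨norm_nonneg _, ?_⟩
      have h3 : D ≤ T'.card * √D := by
        refine hT2.trans ((Finset.sum_le_card_nsmul _ _ _ hall).trans ?_)
        simp
      have h4 : √D * √D = D := Real.mul_self_sqrt hD0
      have h5 := Real.sqrt_nonneg D
      rcases h5.eq_or_lt with h6 | h6
      · rw [← h6]; positivity
      · have : √D ≤ T'.card := by
          by_contra hcon
          push Not at hcon
          nlinarith
        exact this.trans hcard
    · push Not at hall
      obtain ⟨v, hv, hlt⟩ := hall
      refine (min_le_right _ _).trans ((hρ hlt.le).trans (le_trans ?_ (hv1 v)))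
      have := (P v.2).low (X u v) (X w v)
      simpa [θ] using! this
  · obtain ⟨l, h1, h2, h3⟩ := wl_exists hS (g⁻¹ * h)
    have := hup2 l h1 h⁻¹
    rw [h2] at this
    rw [h3]
    simpa using this

/-- Augment a map by an orthonormal family. -/
theorem augment {M E : Type} [Fintype M] [NormedAddCommGroup E] [InnerProductSpace ℝ E]
    [CompleteSpace E] (F : M → E) :
    ∃ (E' : Type) (_ : NormedAddCommGroup E') (_ : InnerProductSpace ℝ E') (_ : CompleteSpace E')
      (F' : M → E'), ∀ x y, (x ≠ y → 1 ≤ ‖F' x - F' y‖) ∧ ‖F x - F y‖ ≤ ‖F' x - F' y‖ ∧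
        ‖F' x - F' y‖ ≤ ‖F x - F y‖ + 2 := by
  classical
  refine ⟨WithLp 2 (E × EuclideanSpace ℝ M), inferInstance, inferInstance, inferInstance,
    fun x => WithLp.toLp 2 (F x, EuclideanSpace.single x 1), fun x y => ?_⟩
  set a := WithLp.toLp 2 (F x, EuclideanSpace.single x (1:ℝ)) -
    WithLp.toLp 2 (F y, EuclideanSpace.single y (1:ℝ)) with ha
  have hsq := WithLp.prod_norm_sq_eq_of_L2 a
  have e1 : a.fst = F x - F y := rfl
  have e2 : a.snd = EuclideanSpace.single x (1:ℝ) - EuclideanSpace.single y (1:ℝ) := rfl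
  rw [e1] at hsq
  have n0 := norm_nonneg a
  have n1 := norm_nonneg (F x - F y)
  have n2 := norm_nonneg a.snd
  have n3 : ‖a.snd‖ ≤ 2 := by
    rw [e2]
    refine (norm_sub_le _ _).trans ?_
    simp
    norm_num
  refine ⟨fun hxy => ?_, ?_, ?_⟩
  · have : 1 ≤ ‖a.snd‖ := by
      rw [e2]
      refine le_trans ?_ (PiLp.norm_apply_le _ x)
      simp [hxy]
    nlinarith
  · apply abs_le_of_sq_le_sq' _ n0 |>.2
    nlinarith
  · apply abs_le_of_sq_le_sq' _ (by positivity) |>.2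
    nlinarith

theorem mkPiece {G : Type*} [Group G] (S : Set G) {A : Type*} [Group A] (SA : Set A)
    (hSA : Submonoid.closure SA = ⊤) (K : Subgroup A) [K.Normal] [K.FiniteIndex]
    (f : A ⧸ K →* G) (hf : ∀ a ∈ SA, f (QuotientGroup.mk a) ∈ S)
    {E : Type} [NormedAddCommGroup E] [InnerProductSpace ℝ E] [CompleteSpace E]
    (F : A ⧸ K → E) (ρm ρp ρ : ℝ → ℝ) (hm : Monotone ρm) (hp : Monotone ρp)
    (hF : ∀ x y, ρm (quotDist (wordLength SA) K x y) ≤ dist (F x) (F y) ∧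
      dist (F x) (F y) ≤ ρp (quotDist (wordLength SA) K x y))
    (hρ : ∀ t, ρ t ≤ ρm t) (C : ℝ) (hC : ρp 1 + 2 ≤ C) :
    ∃ (P : Piece G S ρ) (e : A ⧸ K ≃* P.M), (∀ q, P.θ (e q) = f q) ∧
      ∀ s ∈ SA, ∀ x, ‖P.F (e (QuotientGroup.mk s) * x) - P.F x‖ ≤ C := by
  obtain ⟨M, hM, hMf, ⟨e⟩⟩ := Finite.exists_type_univ_nonempty_mulEquiv.{_, 0} (A ⧸ K)
  obtain ⟨E', i1, i2, i3, F', hF'⟩ := augment (fun m : M => F (e.symm m)⁻¹)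
  have bd : ∀ x y, BddBelow {r : ℝ | ∃ g h : A,
      (QuotientGroup.mk g : A ⧸ K) = x ∧ (QuotientGroup.mk h : A ⧸ K) = y ∧
        wordLength SA (g⁻¹ * h) = r} := by
    intro x y
    refine ⟨0, ?_⟩
    rintro r ⟨g, h, _, _, rfl⟩
    exact wl_nonneg _
  have q1 : ∀ x y, wordLength S (f (x⁻¹ * y)) ≤ quotDist (wordLength SA) K x y := by
    intro x y
    unfold quotDist
    apply le_csInf
    · obtain ⟨g, rfl⟩ := QuotientGroup.mk_surjective x
      obtain ⟨h, rfl⟩ := QuotientGroup.mk_surjective y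
      exact ⟨_, g, h, rfl, rfl, rfl⟩
    · rintro r ⟨g, h, rfl, rfl, rfl⟩
      exact wl_map hSA (f.comp (QuotientGroup.mk' K)) hf (g⁻¹ * h)
  have q2 : ∀ s ∈ SA, ∀ a : A ⧸ K,
      quotDist (wordLength SA) K (QuotientGroup.mk s * a)⁻¹ a⁻¹ ≤ 1 := by
    intro s hs a
    obtain ⟨g, rfl⟩ := QuotientGroup.mk_surjective a
    refine (csInf_le (bd _ _) ⟨(s * g)⁻¹, g⁻¹, rfl, rfl, rfl⟩).trans ?_
    have := wl_le_length (S := SA) [s] (by simpa using hs)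
    simpa using this
  refine ⟨{ M := M, E := E', θ := f.comp e.symm.toMonoidHom, F := F',
            sep := fun x y h => (hF' x y).1 h, low := ?_ }, e, ?_, ?_⟩
  · intro x y
    refine le_trans ?_ (hF' x y).2.1
    have h1 := (hF (e.symm x)⁻¹ (e.symm y)⁻¹).1
    rw [dist_eq_norm] at h1
    refine le_trans ((hρ _).trans (hm ?_)) h1
    simpa using q1 (e.symm x)⁻¹ (e.symm y)⁻¹
  · intro q
    simp
  · intro s hs x
    refine (hF' _ x).2.2.trans (le_trans (add_le_add_left ?_ 2) hC)
    have h1 := (hF (QuotientGroup.mk s * e.symm x)⁻¹ (e.symm x)⁻¹).2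
    rw [dist_eq_norm] at h1
    have h2 := h1.trans (hp (q2 s hs (e.symm x)))
    simpa using h2

/-- The two-element family. -/
def sel {G : Type*} [Group G] {S : Set G} {ρ : ℝ → ℝ} (P Q : Piece G S ρ) : Bool → Piece G S ρ
  | true => P
  | false => Q

theorem two {G A B : Type*} [Group G] [Group A] [Group B] (S : Set G)
    (hS : Submonoid.closure S = ⊤)
    (ρ : ℝ → ℝ) (hρ : Monotone ρ) (C : ℝ) (P Q : Piece G S ρ) (eA : A ≃* P.M) (eB : B ≃* Q.M)
    (φ : Monoid.Coprod A B ≃* G) (hA : ∀ a, P.θ (eA a) = φ (Coprod.inl a))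
    (hB : ∀ b, Q.θ (eB b) = φ (Coprod.inr b))
    (hgen : ∀ s ∈ S, (∃ a, s = φ (Coprod.inl a) ∧ ∀ x, ‖P.F (eA a * x) - P.F x‖ ≤ C) ∨
      (∃ b, s = φ (Coprod.inr b) ∧ ∀ x, ‖Q.F (eB b * x) - Q.F x‖ ≤ C)) :
    ∃ (H : Type) (_ : NormedAddCommGroup H) (_ : InnerProductSpace ℝ H) (_ : CompleteSpace H)
      (Φ : G → H), ∀ g h : G, newRho ρ (wordLength S (g⁻¹ * h)) ≤ dist (Φ g) (Φ h) ∧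
        dist (Φ g) (Φ h) ≤ C * wordLength S (g⁻¹ * h) := by
  let R : Bool → Piece G S ρ := sel P Q
  let eA' : A →* (R true).M := eA.toMonoidHom
  let eB' : B →* (R false).M := eB.toMonoidHom
  let o : ∀ i, (R i).M →* CoprodI (fun i => (R i).M) := fun i =>
    @CoprodI.of Bool (fun i => (R i).M) (fun i => (R i).grp.toMonoid) i
  let ofA : A →* CoprodI (fun i => (R i).M) :=
    (o true).comp eA'
  let ofB : B →* CoprodI (fun i => (R i).M) :=
    (o false).comp eB'
  let η0 : Monoid.Coprod A B →* CoprodI (fun i => (R i).M) := Coprod.lift ofA ofB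
  have key : (CoprodI.lift (fun i => (R i).θ)).comp η0 = φ.toMonoidHom := by
    apply Coprod.hom_ext
    · ext a
      change CoprodI.lift (fun i => (R i).θ) (η0 (Coprod.inl a)) = φ (Coprod.inl a)
      rw [Coprod.lift_apply_inl, ← hA]
      exact CoprodI.lift_of _ _
    · ext a
      change CoprodI.lift (fun i => (R i).θ) (η0 (Coprod.inr a)) = φ (Coprod.inr a)
      rw [Coprod.lift_apply_inr, ← hB]
      exact CoprodI.lift_of _ _
  refine core S hS ρ hρ C R (η0.comp φ.symm.toMonoidHom) ?_ ?_
  · intro g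
    have := DFunLike.congr_fun key (φ.symm g)
    simpa using this
  · intro s hs
    rcases hgen s hs with ⟨a, rfl, ha⟩ | ⟨b, rfl, hb⟩
    · refine ⟨true, eA a, ?_, ha⟩
      simp [η0]
      rfl
    · refine ⟨false, eB b, ?_, hb⟩
      simp [η0]
      rfl

theorem newRho_mono (ρ : ℝ → ℝ) (h : Monotone ρ) : Monotone (newRho ρ) := by
  intro a b hab
  exact min_le_min (Real.sqrt_le_sqrt (Real.sqrt_le_sqrt hab)) (h (Real.sqrt_le_sqrt hab))

theorem tendsto_min' {f g : ℝ → ℝ} (hf : Filter.Tendsto f Filter.atTop Filter.atTop)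
    (hg : Filter.Tendsto g Filter.atTop Filter.atTop) :
    Filter.Tendsto (fun t => min (f t) (g t)) Filter.atTop Filter.atTop := by
  rw [Filter.tendsto_atTop] at *
  intro b
  filter_upwards [hf b, hg b] with t h1 h2
  exact le_min h1 h2

theorem newRho_tendsto (ρ : ℝ → ℝ) (h : Filter.Tendsto ρ Filter.atTop Filter.atTop) :
    Filter.Tendsto (newRho ρ) Filter.atTop Filter.atTop :=
  tendsto_min' (Real.tendsto_sqrt_atTop.comp Real.tendsto_sqrt_atTop)
    (h.comp Real.tendsto_sqrt_atTop)

end S18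

/-- If the faithful quotient sequences `(A ⧸ K_n)` and `(B ⧸ L_n)`
coarsely embed uniformly into Hilbert space, then so does the sequence of free products
`(A ⧸ K_n) ∗ (B ⧸ L_n)` with the word metrics of the images of `S_A ∪ S_B`. -/
theorem statement18 {A B : Type*} [Group A] [Group B]
    (SA : Finset A) (SB : Finset B)
    (hSAsym : ∀ s ∈ SA, s⁻¹ ∈ SA) (hSBsym : ∀ s ∈ SB, s⁻¹ ∈ SB)
    (hSAgen : Subgroup.closure (SA : Set A) = ⊤)
    (hSBgen : Subgroup.closure (SB : Set B) = ⊤)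
    (K : ℕ → Subgroup A) (L : ℕ → Subgroup B)
    [∀ n, (K n).Normal] [∀ n, (L n).Normal]
    (hKfi : ∀ n, (K n).FiniteIndex) (hLfi : ∀ n, (L n).FiniteIndex)
    (hKfaith : ∀ a : A, a ≠ 1 → ∃ N, ∀ n ≥ N, a ∉ K n)
    (hLfaith : ∀ b : B, b ≠ 1 → ∃ N, ∀ n ≥ N, b ∉ L n)
    (hAembed : UnifCoarseEmbedHilbert (fun n => A ⧸ K n)
      (fun n => quotDist (wordLength (SA : Set A)) (K n)))
    (hBembed : UnifCoarseEmbedHilbert (fun n => B ⧸ L n)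
      (fun n => quotDist (wordLength (SB : Set B)) (L n))) :
    UnifCoarseEmbedHilbert (fun n => Monoid.Coprod (A ⧸ K n) (B ⧸ L n))
      (fun n g h => wordLength
        ((⇑(Monoid.Coprod.inl : (A ⧸ K n) →* Monoid.Coprod (A ⧸ K n) (B ⧸ L n)) ''
            ((QuotientGroup.mk : A → A ⧸ K n) '' (SA : Set A))) ∪
          (⇑(Monoid.Coprod.inr : (B ⧸ L n) →* Monoid.Coprod (A ⧸ K n) (B ⧸ L n)) ''
            ((QuotientGroup.mk : B → B ⧸ L n) '' (SB : Set B))))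
        (g⁻¹ * h)) := by
  classical
  have mA := S18.mclosure_of_sym (S := (SA : Set A)) (by simpa using hSAsym) hSAgen
  have mB := S18.mclosure_of_sym (S := (SB : Set B)) (by simpa using hSBsym) hSBgen
  obtain ⟨HA, nA, iA, cA, FA, ma, pa, hma, hpa, hta, hFA⟩ := hAembed
  obtain ⟨HB, nB, iB, cB, FB, mb, pb, hmb, hpb, htb, hFB⟩ := hBembed
  let ρ : ℝ → ℝ := fun t => min (ma t) (mb t)
  have hρ : Monotone ρ := hma.min hmb
  let C : ℝ := max 0 (max (pa 1 + 2) (pb 1 + 2))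
  let S0 : ∀ n, Set (Monoid.Coprod (A ⧸ K n) (B ⧸ L n)) := fun n =>
      ((⇑(Monoid.Coprod.inl : (A ⧸ K n) →* Monoid.Coprod (A ⧸ K n) (B ⧸ L n)) ''
            ((QuotientGroup.mk : A → A ⧸ K n) '' (SA : Set A))) ∪
          (⇑(Monoid.Coprod.inr : (B ⧸ L n) →* Monoid.Coprod (A ⧸ K n) (B ⧸ L n)) ''
            ((QuotientGroup.mk : B → B ⧸ L n) '' (SB : Set B))))
  have main : ∀ n, ∃ (H : Type) (_ : NormedAddCommGroup H) (_ : InnerProductSpace ℝ H)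
      (_ : CompleteSpace H) (Φ : Monoid.Coprod (A ⧸ K n) (B ⧸ L n) → H),
      ∀ g h, S18.newRho ρ (wordLength (S0 n) (g⁻¹ * h)) ≤ dist (Φ g) (Φ h) ∧
        dist (Φ g) (Φ h) ≤ C * wordLength (S0 n) (g⁻¹ * h) := by
    intro n
    let S := S0 n
    have hS : Submonoid.closure S = ⊤ := by
      rw [eq_top_iff, ← Monoid.Coprod.mclosure_range_inl_union_inr, Submonoid.closure_le]
      rintro x (⟨q, rfl⟩ | ⟨q, rfl⟩)
      · obtain ⟨a, rfl⟩ := QuotientGroup.mk_surjective q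
        have ha : a ∈ Submonoid.closure (SA : Set A) := by rw [mA]; trivial
        refine (Submonoid.closure_le (S := (Submonoid.closure S).comap
          (Monoid.Coprod.inl.comp (QuotientGroup.mk' (K n))))).2 ?_ ha
        intro s hs
        exact Submonoid.subset_closure (Or.inl ⟨_, ⟨s, hs, rfl⟩, rfl⟩)
      · obtain ⟨a, rfl⟩ := QuotientGroup.mk_surjective q
        have ha : a ∈ Submonoid.closure (SB : Set B) := by rw [mB]; trivial
        refine (Submonoid.closure_le (S := (Submonoid.closure S).comap
          (Monoid.Coprod.inr.comp (QuotientGroup.mk' (L n))))).2 ?_ ha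
        intro s hs
        exact Submonoid.subset_closure (Or.inr ⟨_, ⟨s, hs, rfl⟩, rfl⟩)
    let _ := nA n
    let _ := iA n
    let _ := cA n
    let _ := nB n
    let _ := iB n
    let _ := cB n
    have := hKfi n
    have := hLfi n
    obtain ⟨P, eA, hP1, hP2⟩ := S18.mkPiece S (SA : Set A) mA (K n) Monoid.Coprod.inl
      (fun a ha => Or.inl ⟨_, ⟨a, ha, rfl⟩, rfl⟩) (FA n) ma pa ρ hma hpa (hFA n)
      (fun t => min_le_left _ _) C ((le_max_left _ _).trans (le_max_right _ _))
    obtain ⟨Q, eB, hQ1, hQ2⟩ := S18.mkPiece S (SB : Set B) mB (L n) Monoid.Coprod.inr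
      (fun a ha => Or.inr ⟨_, ⟨a, ha, rfl⟩, rfl⟩) (FB n) mb pb ρ hmb hpb (hFB n)
      (fun t => min_le_right _ _) C ((le_max_right _ _).trans (le_max_right _ _))
    refine S18.two S hS ρ hρ C P Q eA eB (MulEquiv.refl _) hP1 hQ1 ?_
    rintro s (⟨_, ⟨a, ha, rfl⟩, rfl⟩ | ⟨_, ⟨a, ha, rfl⟩, rfl⟩)
    · exact Or.inl ⟨_, rfl, hP2 a ha⟩
    · exact Or.inr ⟨_, rfl, hQ2 a ha⟩
  choose H iN iI iC Φ hΦ using main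
  refine ⟨H, iN, iI, iC, Φ, S18.newRho ρ, fun t => C * t, S18.newRho_mono ρ hρ, ?_,
    S18.newRho_tendsto ρ (S18.tendsto_min' hta htb), fun j x y => hΦ j x y⟩
  intro a b hab
  exact mul_le_mul_of_nonneg_left hab (le_max_left _ _)
end
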